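/- arXiv:1506.03508 — 3 statements merged into one kernel-verified Lean document; each statement's English description precedes it below -/
import Mathlib

section
/- (Order polynomial reciprocity.) There exist polynomials f, g ∈ ℚ[X] such that f(m) = Ω(P; m) and g(m) = Ω̄(P; m) for every natural number m, and these polynomials satisfy g(X) = (−1)^p · f(−X). -/
open scoped Classical

/-- A `P`-partition: `σ j ≤ σ i` whenever `i ≺ j`, strictly whenever additionally
`i > j` as integers. -/
def IsPPartition (p : ℕ) (P : PartialOrder (Fin p)) (σ : Fin p → ℕ) : Prop :=
  ∀ i j : Fin p, P.lt i j → σ j ≤ σ i ∧ (j < i → σ j < σ i)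

/-- A `P̄`-partition (complementary labeling): `σ j ≤ σ i` whenever `i ≺ j`,
strictly whenever additionally `i < j` as integers. -/
def IsPbarPartition (p : ℕ) (P : PartialOrder (Fin p)) (σ : Fin p → ℕ) : Prop :=
  ∀ i j : Fin p, P.lt i j → σ j ≤ σ i ∧ (i < j → σ j < σ i)

/-- `Ω(P; m)` : the number of `P`-partitions with all values in `{0, …, m-1}`. -/
noncomputable def orderPolyVal (p : ℕ) (P : PartialOrder (Fin p)) (m : ℕ) : ℕ :=
  (Finset.univ.filter (fun σ : Fin p → Fin m =>
      IsPPartition p P fun i => (σ i : ℕ))).card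

/-- `Ω̄(P; m)` : the number of `P̄`-partitions with all values in `{0, …, m-1}`. -/
noncomputable def orderPolyBarVal (p : ℕ) (P : PartialOrder (Fin p)) (m : ℕ) : ℕ :=
  (Finset.univ.filter (fun σ : Fin p → Fin m =>
      IsPbarPartition p P fun i => (σ i : ℕ))).card

open Finset Polynomial

/-- The ascents of a permutation, an ascent at `i` being recorded as `w i < w (i + 1)`. -/
def ascents {n : ℕ} (w : Equiv.Perm (Fin (n + 1))) : Finset (Fin n) :=
  univ.filter fun i => w i.castSucc < w i.succ

/-- The number of ascents of a permutation at positions below `k`. -/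
def ascentsBelow {n : ℕ} (w : Equiv.Perm (Fin (n + 1))) (k : Fin (n + 1)) : ℕ :=
  #((ascents w).filter fun i => i.castSucc < k)

theorem ascentsBelow_zero {n : ℕ} (w : Equiv.Perm (Fin (n + 1))) : ascentsBelow w 0 = 0 := by
  simp [ascentsBelow]

theorem ascentsBelow_last {n : ℕ} (w : Equiv.Perm (Fin (n + 1))) :
    ascentsBelow w (Fin.last n) = #(ascents w) := by
  simp [ascentsBelow, Fin.castSucc_lt_last]

theorem ascentsBelow_succ {n : ℕ} (w : Equiv.Perm (Fin (n + 1))) (i : Fin n) :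
    ascentsBelow w i.succ =
      ascentsBelow w i.castSucc + if w i.castSucc < w i.succ then 1 else 0 := by
  have h : (ascents w).filter (fun j => j.castSucc < i.succ) =
      (ascents w).filter (fun j => j.castSucc < i.castSucc) ∪
        (ascents w).filter (fun j => j = i) := by
    ext j
    simp only [mem_filter, mem_union, Fin.lt_def, Fin.ext_iff, Fin.val_castSucc, Fin.val_succ,
      Nat.lt_succ_iff_lt_or_eq, and_or_left]
  rw [ascentsBelow, h, card_union_of_disjoint, ascentsBelow, filter_eq']
  · congr 1
    simp only [ascents, mem_filter, mem_univ, true_and]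
    split_ifs <;> simp
  · rw [disjoint_filter]
    rintro j - hj rfl
    exact lt_irrefl _ hj

theorem card_ascents_revPerm_trans {n : ℕ} (w : Equiv.Perm (Fin (n + 1))) :
    #(ascents (Fin.revPerm.trans w)) + #(ascents w) = n := by
  have h : #(ascents (Fin.revPerm.trans w)) =
      #(univ.filter fun i : Fin n => ¬ w i.castSucc < w i.succ) := by
    refine card_nbij' Fin.rev Fin.rev ?_ ?_ (fun i _ => Fin.rev_rev i) (fun i _ => Fin.rev_rev i)
    · intro i hi
      simp only [ascents, coe_filter, mem_univ, true_and, Set.mem_ofPred_eq, Equiv.trans_apply,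
        Fin.revPerm_apply, Fin.rev_castSucc, Fin.rev_succ] at hi ⊢
      exact hi.le.not_gt
    · intro i hi
      simp only [ascents, coe_filter, mem_univ, true_and, Set.mem_ofPred_eq, Equiv.trans_apply,
        Fin.revPerm_apply, Fin.rev_castSucc, Fin.rev_succ, Fin.rev_rev, not_lt] at hi ⊢
      exact hi.lt_of_ne fun h => (Fin.castSucc_lt_succ (i := i)).ne' (w.injective h)
  rw [h, add_comm, ascents, card_filter_add_card_filter_not, card_univ, Fintype.card_fin]

theorem eq_sort_iff_forall_succ {n : ℕ} {α : Type*} [LinearOrder α]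
    {w : Equiv.Perm (Fin (n + 1))} {σ : Fin (n + 1) → α} :
    w = Tuple.sort σ ↔ ∀ i : Fin n, σ (w i.castSucc) < σ (w i.succ) ∨
      σ (w i.castSucc) = σ (w i.succ) ∧ w i.castSucc < w i.succ := by
  rw [Tuple.eq_sort_iff', Fin.strictMono_iff_lt_succ]
  exact forall_congr' fun i => Prod.Lex.toLex_lt_toLex

theorem eq_sort_iff_strictMono {n m : ℕ} {w : Equiv.Perm (Fin (n + 1))}
    {σ : Fin (n + 1) → Fin m} :
    w = Tuple.sort σ ↔ StrictMono fun k => (σ (w k) : ℕ) + ascentsBelow w k := by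
  rw [eq_sort_iff_forall_succ, Fin.strictMono_iff_lt_succ]
  refine forall_congr' fun i => ?_
  rw [ascentsBelow_succ, Fin.lt_def, Fin.ext_iff]
  split_ifs with h <;> simp only [h, and_true, and_false, or_false] <;> omega

theorem monotone_sub_ascentsBelow {n N : ℕ} (w : Equiv.Perm (Fin (n + 1)))
    (u : Fin (n + 1) ↪o Fin N) : Monotone fun k => ((u k : ℕ) : ℤ) - ascentsBelow w k := by
  rw [Fin.monotone_iff_le_succ]
  intro i
  have h : (u i.castSucc : ℕ) < u i.succ := u.strictMono Fin.castSucc_lt_succ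
  simp only [ascentsBelow_succ]
  split_ifs <;> push_cast <;> omega

theorem ascentsBelow_le {n N : ℕ} (w : Equiv.Perm (Fin (n + 1))) (u : Fin (n + 1) ↪o Fin N)
    (k : Fin (n + 1)) : ascentsBelow w k ≤ u k := by
  have h := monotone_sub_ascentsBelow w u (Fin.zero_le k)
  simp only [ascentsBelow_zero] at h
  omega

theorem sub_ascentsBelow_lt {n m : ℕ} (w : Equiv.Perm (Fin (n + 1)))
    (u : Fin (n + 1) ↪o Fin (m + #(ascents w))) (k : Fin (n + 1)) :
    (u k : ℕ) - ascentsBelow w k < m := by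
  have h := monotone_sub_ascentsBelow w u (Fin.le_last k)
  simp only [ascentsBelow_last] at h
  have := ascentsBelow_le w u k
  have := (u (Fin.last n)).isLt
  omega

theorem ascentsBelow_le_card {n : ℕ} (w : Equiv.Perm (Fin (n + 1))) (k : Fin (n + 1)) :
    ascentsBelow w k ≤ #(ascents w) :=
  card_filter_le _ _

/-- Tuples sorted by `w` correspond to strictly increasing tuples, by adding to each entry the
number of preceding ascents of `w`. -/
def sortEqEquiv {n : ℕ} (m : ℕ) (w : Equiv.Perm (Fin (n + 1))) :
    {σ : Fin (n + 1) → Fin m // w = Tuple.sort σ} ≃ (Fin (n + 1) ↪o Fin (m + #(ascents w))) where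
  toFun σ := OrderEmbedding.ofStrictMono
    (fun k => ⟨σ.1 (w k) + ascentsBelow w k,
      add_lt_add_of_lt_of_le (σ.1 (w k)).isLt (ascentsBelow_le_card w k)⟩)
    fun _ _ h => eq_sort_iff_strictMono.1 σ.2 h
  invFun u := ⟨fun x => ⟨u (w.symm x) - ascentsBelow w (w.symm x), sub_ascentsBelow_lt w u _⟩, by
    rw [eq_sort_iff_strictMono]
    intro i j h
    simpa [Nat.sub_add_cancel (ascentsBelow_le w u _)] using h⟩
  left_inv σ := by
    ext x
    simp [OrderEmbedding.ofStrictMono]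
  right_inv u := by
    ext k
    simp [Nat.sub_add_cancel (ascentsBelow_le w u _)]

theorem card_sort_eq {n : ℕ} (m : ℕ) (w : Equiv.Perm (Fin (n + 1))) :
    #(univ.filter fun σ : Fin (n + 1) → Fin m => Tuple.sort σ = w) =
      (m + #(ascents w)).choose (n + 1) := by
  rw [← Fintype.card_subtype, ← Nat.card_eq_fintype_card]
  simp only [eq_comm (b := w)]
  rw [Nat.card_congr ((sortEqEquiv m w).trans Set.powersetCard.ofFinEmbEquiv),
    Set.powersetCard.card, Nat.card_fin]

/-- The permutations listing the elements of a poset in decreasing order. -/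
noncomputable def reverseLinearExtensions {n : ℕ} (P : PartialOrder (Fin n)) :
    Finset (Equiv.Perm (Fin n)) :=
  univ.filter fun w => ∀ i j, P.lt i j → w.symm j < w.symm i

theorem sort_symm_lt_iff {n : ℕ} {α : Type*} [LinearOrder α] (σ : Fin n → α) (i j : Fin n) :
    (Tuple.sort σ).symm j < (Tuple.sort σ).symm i ↔ σ j < σ i ∨ σ j = σ i ∧ j < i := by
  rw [← (Tuple.eq_sort_iff'.1 (rfl : Tuple.sort σ = Tuple.sort σ)).lt_iff_lt]
  simpa [Subtype.mk_lt_mk] using! Prod.Lex.toLex_lt_toLex (x := (σ j, j)) (y := (σ i, i))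

theorem isPbarPartition_iff_sort_mem {p m : ℕ} (P : PartialOrder (Fin p)) (σ : Fin p → Fin m) :
    IsPbarPartition p P (fun i => (σ i : ℕ)) ↔ Tuple.sort σ ∈ reverseLinearExtensions P := by
  simp only [reverseLinearExtensions, mem_filter, mem_univ, true_and, sort_symm_lt_iff]
  refine forall₃_congr fun i j hij => ?_
  have hne : i ≠ j := by
    rintro rfl
    exact @lt_irrefl _ P.toPreorder i hij
  clear hij
  rw [Ne, Fin.ext_iff] at hne
  simp only [Fin.lt_def, Fin.ext_iff]
  omega

theorem orderPolyBarVal_eq_sum {n : ℕ} (P : PartialOrder (Fin (n + 1))) (m : ℕ) :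
    orderPolyBarVal (n + 1) P m =
      ∑ w ∈ reverseLinearExtensions P, (m + #(ascents w)).choose (n + 1) := by
  simp only [orderPolyBarVal, isPbarPartition_iff_sort_mem, ← card_sort_eq]
  rw [card_eq_sum_card_fiberwise (f := Tuple.sort) (t := reverseLinearExtensions P)
    (fun σ hσ => by simpa using hσ)]
  refine sum_congr rfl fun w hw => ?_
  rw [filter_filter]
  congr 1
  ext σ
  simp only [mem_filter, mem_univ, true_and]
  exact ⟨And.right, fun h => ⟨h ▸ hw, h⟩⟩

/-- The opposite of a partial order. -/
abbrev oppositeOrder {α : Type*} (P : PartialOrder α) : PartialOrder α :=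
  @OrderDual.instPartialOrder α P

theorem orderPolyVal_eq_orderPolyBarVal_opposite (p : ℕ) (P : PartialOrder (Fin p)) (m : ℕ) :
    orderPolyVal p P m = orderPolyBarVal p (oppositeOrder P) m := by
  have key (σ : Fin p → Fin m) : IsPPartition p P (fun i => (σ i : ℕ)) ↔
      IsPbarPartition p (oppositeOrder P) (fun i => ((σ i).rev : ℕ)) := by
    rw [IsPPartition, forall_comm]
    refine forall₃_congr fun i j hij => ?_
    simp only [← Fin.lt_def, ← Fin.le_def, Fin.rev_le_rev, Fin.rev_lt_rev]
  refine card_nbij' (fun σ i => (σ i).rev) (fun σ i => (σ i).rev) ?_ ?_ ?_ ?_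
  · intro σ hσ
    simpa only [coe_filter, mem_univ, true_and, Set.mem_ofPred_eq, key] using hσ
  · intro σ hσ
    simpa only [coe_filter, mem_univ, true_and, Set.mem_ofPred_eq, key, Fin.rev_rev] using hσ
  · intro σ _
    simp
  · intro σ _
    simp

theorem sum_reverseLinearExtensions_opposite {n : ℕ} {M : Type*} [AddCommMonoid M]
    (P : PartialOrder (Fin n)) (F : Equiv.Perm (Fin n) → M) :
    ∑ w ∈ reverseLinearExtensions (oppositeOrder P), F w =
      ∑ w ∈ reverseLinearExtensions P, F (Fin.revPerm.trans w) := by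
  have hinv (w : Equiv.Perm (Fin n)) : Fin.revPerm.trans (Fin.revPerm.trans w) = w := by
    ext
    simp
  have hmem (Q : PartialOrder (Fin n)) (w : Equiv.Perm (Fin n))
      (hw : w ∈ reverseLinearExtensions Q) :
      Fin.revPerm.trans w ∈ reverseLinearExtensions (oppositeOrder Q) := by
    simp only [reverseLinearExtensions, mem_filter, mem_univ, true_and] at hw ⊢
    intro i j hij
    simpa using hw j i hij
  exact sum_nbij' (fun w => Fin.revPerm.trans w) (fun w => Fin.revPerm.trans w)
    (fun w hw => hmem _ w hw) (fun w hw => hmem _ w hw) (fun w _ => hinv w) (fun w _ => hinv w)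
    fun w _ => by rw [hinv]

/-- The polynomial `(X + a).choose p`. -/
noncomputable def shiftedChoose (p a : ℕ) : ℚ[X] :=
  C (p.factorial : ℚ)⁻¹ * (descPochhammer ℚ p).comp (X + C (a : ℚ))

theorem shiftedChoose_eval (p a m : ℕ) :
    (shiftedChoose p a).eval (m : ℚ) = (m + a).choose p := by
  rw [shiftedChoose, eval_mul, eval_C, eval_comp, eval_add, eval_X, eval_C, ← Nat.cast_add,
    descPochhammer_eval_eq_descFactorial, Nat.descFactorial_eq_factorial_mul_choose]
  push_cast
  exact inv_mul_cancel_left₀ (by positivity) _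

theorem shiftedChoose_reciprocity {n a b : ℕ} (h : a + b = n) :
    shiftedChoose (n + 1) b =
      C ((-1 : ℚ) ^ (n + 1)) * (shiftedChoose (n + 1) a).comp (-X) := by
  refine Polynomial.funext fun x => ?_
  simp only [shiftedChoose, eval_mul, eval_C, eval_comp, eval_add, eval_neg, eval_X]
  rw [descPochhammer_eval_eq_ascPochhammer ℚ (-x + a),
    show -x + (a : ℚ) - (n + 1 : ℕ) + 1 = -(x + b) by subst h; push_cast; ring,
    ascPochhammer_eval_neg_eq_descPochhammer, mul_left_comm (_⁻¹ : ℚ), ← mul_assoc, ← mul_pow]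
  simp

/-- **Order polynomial reciprocity** : there are polynomials `f, g ∈ ℚ[X]` with
`f(m) = Ω(P; m)`, `g(m) = Ω̄(P; m)` for all natural `m`, and `g(X) = (-1)^p f(-X)`. -/
theorem order_polynomial_reciprocity (p : ℕ) (hp : 0 < p) (P : PartialOrder (Fin p)) :
    ∃ f g : Polynomial ℚ,
      (∀ m : ℕ, f.eval (m : ℚ) = orderPolyVal p P m) ∧
      (∀ m : ℕ, g.eval (m : ℚ) = orderPolyBarVal p P m) ∧
      g = Polynomial.C ((-1 : ℚ) ^ p) * f.comp (-Polynomial.X) := by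
  obtain ⟨n, rfl⟩ := Nat.exists_eq_add_one.2 hp
  refine ⟨∑ w ∈ reverseLinearExtensions (oppositeOrder P), shiftedChoose (n + 1) #(ascents w),
    ∑ w ∈ reverseLinearExtensions P, shiftedChoose (n + 1) #(ascents w), fun m => ?_,
    fun m => ?_, ?_⟩
  · simp [orderPolyVal_eq_orderPolyBarVal_opposite, orderPolyBarVal_eq_sum, eval_finsetSum,
      shiftedChoose_eval]
  · simp [orderPolyBarVal_eq_sum, eval_finsetSum, shiftedChoose_eval]
  · rw [sum_reverseLinearExtensions_opposite, Polynomial.sum_comp, mul_sum]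
    exact sum_congr rfl fun w _ => shiftedChoose_reciprocity (card_ascents_revPerm_trans w)
end

section
/- (Stanley, Proposition 19.3.) Suppose the partial order ⪯ on [p] is naturally labeled, i.e. i ≺ j implies i < j as integers, and suppose every maximal chain of ([p], ⪯) has exactly l+1 elements (length l). Then: (a) for every s, the number of linear extensions π ∈ L(P) with des(π) = s equals the number with des(π) = p − 1 − l − s; and (b) there exists a polynomial f ∈ ℚ[X] with f(m) = Ω(P; m) for all natural m, which satisfies f(X) = (−1)^p · f(−l−X). -/
open scoped Classical

/-- `π` is a linear extension of `P`. -/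
def IsLinExt (p : ℕ) (P : PartialOrder (Fin p)) (π : Equiv.Perm (Fin p)) : Prop :=
  ∀ i j : Fin p, P.lt (π i) (π j) → i < j

/-- The descent set (1-based positions). -/
def desSet (p : ℕ) (f : Fin p → ℕ) : Finset ℕ :=
  (Finset.Ico 1 p).filter fun i =>
    ∃ (h1 : i - 1 < p) (h2 : i < p), f ⟨i, h2⟩ < f ⟨i - 1, h1⟩

namespace OrderPolynomial

open Finset

theorem card_strictMono (k N : ℕ) :
    (univ.filter fun u : Fin k → Fin N => StrictMono u).card = N.choose k := by
  have h : (univ.filter fun u : Fin k → Fin N => StrictMono u).card =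
      Nat.card (Fin k ↪o Fin N) := by
    rw [← Fintype.card_subtype, ← Nat.card_eq_fintype_card]
    exact Nat.card_congr
      { toFun := fun u => OrderEmbedding.ofStrictMono u.1 u.2
        invFun := fun e => ⟨e, e.strictMono⟩
        left_inv := fun _ => rfl
        right_inv := fun _ => rfl }
  rw [h, Nat.card_congr Set.powersetCard.ofFinEmbEquiv, Set.powersetCard.card,
    Nat.card_eq_fintype_card, Fintype.card_fin]

/-- The number of strict ascents of `w` strictly before position `i`. -/
noncomputable def ascentsBefore {q : ℕ} (w : Fin (q + 1) → ℤ) (i : Fin (q + 1)) : ℕ :=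
  (univ.filter fun k : Fin q => k.castSucc < i ∧ w k.castSucc < w k.succ).card

/-- The number of strict ascents of `w`. -/
noncomputable def ascents {q : ℕ} (w : Fin (q + 1) → ℤ) : ℕ :=
  (univ.filter fun k : Fin q => w k.castSucc < w k.succ).card

theorem ascentsBefore_zero {q : ℕ} (w : Fin (q + 1) → ℤ) : ascentsBefore w 0 = 0 := by
  simp [ascentsBefore]

theorem ascentsBefore_last {q : ℕ} (w : Fin (q + 1) → ℤ) :
    ascentsBefore w (Fin.last q) = ascents w := by
  simp [ascentsBefore, ascents, Fin.castSucc_lt_last]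

theorem ascentsBefore_succ {q : ℕ} (w : Fin (q + 1) → ℤ) (k : Fin q) :
    ascentsBefore w k.succ =
      ascentsBefore w k.castSucc + if w k.castSucc < w k.succ then 1 else 0 := by
  have h : (univ.filter fun j : Fin q => j.castSucc < k.succ ∧ w j.castSucc < w j.succ) =
      (univ.filter fun j : Fin q => j.castSucc < k.castSucc ∧ w j.castSucc < w j.succ) ∪
        if w k.castSucc < w k.succ then {k} else ∅ := by
    ext j
    have hj : j.castSucc < k.succ ↔ j.castSucc < k.castSucc ∨ j = k := by
      simp only [Fin.lt_def, Fin.ext_iff, Fin.val_castSucc, Fin.val_succ]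
      omega
    split_ifs with hk
    · simp only [mem_filter, mem_univ, true_and, mem_union, mem_singleton, hj]
      constructor
      · rintro ⟨h | h, h'⟩
        · exact Or.inl ⟨h, h'⟩
        · exact Or.inr h
      · rintro (h | rfl)
        · exact ⟨Or.inl h.1, h.2⟩
        · exact ⟨Or.inr rfl, hk⟩
    · simp only [mem_filter, mem_univ, true_and, hj, union_empty]
      constructor
      · rintro ⟨h | rfl, h'⟩
        · exact ⟨h, h'⟩
        · exact absurd h' hk
      · rintro h
        exact ⟨Or.inl h.1, h.2⟩
  unfold ascentsBefore
  rw [h, card_union_of_disjoint]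
  · split_ifs <;> simp
  · split_ifs <;> simp

theorem monotone_ascentsBefore {q : ℕ} (w : Fin (q + 1) → ℤ) : Monotone (ascentsBefore w) := by
  rw [Fin.monotone_iff_le_succ]
  intro k
  rw [ascentsBefore_succ]
  omega

theorem strictMono_toLex_iff {q m : ℕ} (w : Fin (q + 1) → ℤ) (v : Fin (q + 1) → Fin m) :
    StrictMono (fun i => toLex (v i, w i)) ↔
      StrictMono (fun i => (v i : ℕ) + ascentsBefore w i) := by
  rw [Fin.strictMono_iff_lt_succ, Fin.strictMono_iff_lt_succ]
  refine forall_congr' fun k => ?_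
  rw [ascentsBefore_succ, Prod.Lex.toLex_lt_toLex]
  simp only [Fin.lt_def, Fin.ext_iff]
  split_ifs with h
  · simp only [h, and_true]
    omega
  · simp only [h, and_false, or_false]
    omega

theorem monotone_sub_ascentsBefore {q N : ℕ} (w : Fin (q + 1) → ℤ) (u : Fin (q + 1) → Fin N)
    (hu : StrictMono u) : Monotone (fun i => ((u i : ℕ) : ℤ) - ascentsBefore w i) := by
  rw [Fin.monotone_iff_le_succ]
  intro k
  have h := hu (Fin.castSucc_lt_succ (i := k))
  rw [ascentsBefore_succ]
  rw [Fin.lt_def] at h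
  split_ifs <;> push_cast <;> omega

theorem card_strictMono_toLex {q : ℕ} (m : ℕ) (w : Fin (q + 1) → ℤ) :
    (univ.filter fun v : Fin (q + 1) → Fin m => StrictMono fun i => toLex (v i, w i)).card =
      (m + ascents w).choose (q + 1) := by
  rw [← card_strictMono]
  have hlast : ∀ i, ascentsBefore w i ≤ ascents w := fun i => by
    rw [← ascentsBefore_last]
    exact monotone_ascentsBefore w (Fin.le_last i)
  have hlow : ∀ u : Fin (q + 1) → Fin (m + ascents w), StrictMono u →
      ∀ i, ascentsBefore w i ≤ u i := fun u hu i => by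
    have := monotone_sub_ascentsBefore w u hu (Fin.zero_le i)
    simp only [ascentsBefore_zero] at this
    omega
  have hupp : ∀ u : Fin (q + 1) → Fin (m + ascents w), StrictMono u →
      ∀ i, (u i : ℕ) - ascentsBefore w i < m := fun u hu i => by
    have := monotone_sub_ascentsBefore w u hu (Fin.le_last i)
    simp only [ascentsBefore_last] at this
    have := hlow u hu i
    have := (u (Fin.last q)).isLt
    omega
  refine Finset.card_bij'
    (fun v _ i => ⟨v i + ascentsBefore w i, by have := hlast i; have := (v i).isLt; omega⟩)
    (fun u hu i => ⟨u i - ascentsBefore w i, hupp u (mem_filter.1 hu).2 i⟩) ?_ ?_ ?_ ?_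
  · intro v hv
    rw [mem_filter, strictMono_toLex_iff] at hv
    rw [mem_filter]
    exact ⟨mem_univ _, fun i j hij => hv.2 hij⟩
  · intro u hu
    have hu' := (mem_filter.1 hu).2
    rw [mem_filter, strictMono_toLex_iff]
    refine ⟨mem_univ _, fun i j hij => ?_⟩
    simp only [Nat.sub_add_cancel (hlow u hu' _)]
    exact hu' hij
  · intro v _
    ext i
    simp
  · intro u hu
    ext i
    simp [Nat.sub_add_cancel (hlow u (mem_filter.1 hu).2 _)]

theorem existsUnique_strictMono_comp_perm {α : Type*} [LinearOrder α] {n : ℕ} (f : Fin n → α)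
    (hf : Function.Injective f) : ∃! π : Equiv.Perm (Fin n), StrictMono (f ∘ π) := by
  refine ⟨Tuple.sort f, (Tuple.monotone_sort f).strictMono_of_injective
    (hf.comp (Equiv.injective _)), fun π hπ => ?_⟩
  have h := Tuple.unique_monotone hπ.monotone (Tuple.monotone_sort f)
  exact Equiv.ext fun i => hf (congrFun h i)

/-- `π` lists `Fin p` in decreasing order of `σ`, breaking ties by increasing label `ω`. -/
def IsSortedBy {p m : ℕ} (ω : Fin p → ℤ) (σ : Fin p → Fin m) (π : Equiv.Perm (Fin p)) : Prop :=
  StrictMono ((fun i => toLex ((σ i).rev, ω i)) ∘ π)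

theorem IsSortedBy.lt_iff {p m : ℕ} {ω : Fin p → ℤ} {σ : Fin p → Fin m}
    {π : Equiv.Perm (Fin p)} (h : IsSortedBy ω σ π) (i j : Fin p) :
    i < j ↔ σ (π j) < σ (π i) ∨ σ (π i) = σ (π j) ∧ ω (π i) < ω (π j) := by
  rw [← StrictMono.lt_iff_lt h]
  simp only [Function.comp, Prod.Lex.toLex_lt_toLex, Fin.rev_lt_rev, Fin.rev_inj]

theorem existsUnique_isSortedBy {p m : ℕ} {ω : Fin p → ℤ} (hω : Function.Injective ω)
    (σ : Fin p → Fin m) : ∃! π : Equiv.Perm (Fin p), IsSortedBy ω σ π :=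
  existsUnique_strictMono_comp_perm _ fun _ _ hij =>
    hω (Prod.ext_iff.1 (toLex.injective hij)).2

/-- `σ` weakly reverses the order of `P`, strictly where the labels `ω` decrease. -/
def IsLabeledPartition {p : ℕ} (P : PartialOrder (Fin p)) (ω : Fin p → ℤ) (σ : Fin p → ℕ) :
    Prop :=
  ∀ i j : Fin p, P.lt i j → σ j ≤ σ i ∧ (ω j < ω i → σ j < σ i)

theorem isLabeledPartition_iff_isLinExt {p m : ℕ} (P : PartialOrder (Fin p)) (ω : Fin p → ℤ)
    (hω : Function.Injective ω) (σ : Fin p → Fin m) (π : Equiv.Perm (Fin p))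
    (hπ : IsSortedBy ω σ π) :
    IsLabeledPartition P ω (fun i => (σ i : ℕ)) ↔ IsLinExt p P π := by
  constructor
  · intro h i j hij
    obtain ⟨h1, h2⟩ := h _ _ hij
    rw [hπ.lt_iff]
    have hne : ω (π i) ≠ ω (π j) := fun h => by
      rw [hω h] at hij
      exact (@lt_irrefl _ P.toPreorder _) hij
    rcases h1.lt_or_eq with h3 | h3
    · exact Or.inl h3
    · refine Or.inr ⟨Fin.ext h3.symm, lt_of_le_of_ne ?_ hne⟩
      by_contra h4
      have := h2 (not_le.1 h4)
      omega
  · intro h a b hab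
    have h1 : P.lt (π (π.symm a)) (π (π.symm b)) := by simpa using hab
    have h2 := (hπ.lt_iff _ _).1 (h _ _ h1)
    simp only [Equiv.apply_symm_apply] at h2
    rcases h2 with h2 | ⟨h2, h3⟩
    · exact ⟨h2.le, fun _ => h2⟩
    · dsimp only
      rw [h2]
      exact ⟨le_rfl, fun h4 => absurd h4 h3.not_gt⟩

theorem card_compatible {q : ℕ} (m : ℕ) (ω : Fin (q + 1) → ℤ) (π : Equiv.Perm (Fin (q + 1))) :
    (univ.filter fun σ : Fin (q + 1) → Fin m =>
      IsSortedBy ω σ π).card =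
      (m + ascents (ω ∘ π)).choose (q + 1) := by
  rw [← card_strictMono_toLex]
  refine Finset.card_equiv ((Equiv.arrowCongr π.symm Fin.revPerm)) fun σ => ?_
  simp only [mem_filter, mem_univ, true_and]
  exact Iff.rfl

theorem card_isLabeledPartition {q : ℕ} (P : PartialOrder (Fin (q + 1))) (ω : Fin (q + 1) → ℤ)
    (hω : Function.Injective ω) (m : ℕ) :
    (univ.filter fun σ : Fin (q + 1) → Fin m =>
      IsLabeledPartition P ω fun i => (σ i : ℕ)).card =
      ∑ π : Equiv.Perm (Fin (q + 1)) with IsLinExt (q + 1) P π,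
        (m + ascents (ω ∘ π)).choose (q + 1) := by
  have h := sum_card_bipartiteAbove_eq_sum_card_bipartiteBelow
    (s := univ.filter fun σ : Fin (q + 1) → Fin m => IsLabeledPartition P ω fun i => (σ i : ℕ))
    (t := univ.filter fun π : Equiv.Perm (Fin (q + 1)) => IsLinExt (q + 1) P π)
    (fun (σ : Fin (q + 1) → Fin m) (π : Equiv.Perm (Fin (q + 1))) => IsSortedBy ω σ π)
  rw [card_eq_sum_ones]
  refine Eq.trans (sum_congr rfl fun σ hσ => ?_) (h.trans (sum_congr rfl fun π hπ => ?_))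
  · obtain ⟨π, hπ, huniq⟩ := existsUnique_isSortedBy hω σ
    symm
    rw [card_eq_one]
    refine ⟨π, ?_⟩
    ext π'
    simp only [bipartiteAbove, mem_filter, mem_univ, true_and, mem_singleton]
    constructor
    · exact fun h => huniq _ h.2
    · rintro rfl
      exact ⟨(isLabeledPartition_iff_isLinExt P ω hω σ π' hπ).1 (mem_filter.1 hσ).2, hπ⟩
  · rw [← card_compatible]
    congr 1
    ext σ
    simp only [bipartiteBelow, mem_filter, mem_univ, true_and, and_iff_right_iff_imp]
    exact fun hσ => (isLabeledPartition_iff_isLinExt P ω hω σ π hσ).2 (mem_filter.1 hπ).2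

section Chains

variable {α : Type*} [PartialOrder α] [Fintype α]

theorem exists_max_card_chain (s : Set α) :
    ∃ C : Finset α, IsChain (· < ·) (C : Set α) ∧ (C : Set α) ⊆ s ∧
      ∀ D : Finset α, IsChain (· < ·) (D : Set α) → (D : Set α) ⊆ s → D.card ≤ C.card := by
  obtain ⟨C, hC, hmax⟩ := exists_max_image
    (univ.filter fun C : Finset α => IsChain (· < ·) (C : Set α) ∧ (C : Set α) ⊆ s) card
    ⟨∅, by simp⟩
  simp only [mem_filter, mem_univ, true_and] at hC hmax
  exact ⟨C, hC.1, hC.2, fun D h1 h2 => hmax D ⟨h1, h2⟩⟩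

/-- The largest cardinality of a chain contained in `s`. -/
noncomputable def chainNumber (s : Set α) : ℕ :=
  (exists_max_card_chain s).choose.card

theorem exists_card_eq_chainNumber (s : Set α) :
    ∃ C : Finset α, IsChain (· < ·) (C : Set α) ∧ (C : Set α) ⊆ s ∧ C.card = chainNumber s :=
  ⟨_, (exists_max_card_chain s).choose_spec.1, (exists_max_card_chain s).choose_spec.2.1, rfl⟩

theorem card_le_chainNumber {s : Set α} {D : Finset α} (hD : IsChain (· < ·) (D : Set α))
    (hs : (D : Set α) ⊆ s) : D.card ≤ chainNumber s :=
  (exists_max_card_chain s).choose_spec.2.2 D hD hs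

theorem chainNumber_eq_zero {s : Set α} (hs : s = ∅) : chainNumber s = 0 := by
  obtain ⟨C, -, h, h'⟩ := exists_card_eq_chainNumber s
  rw [← h', card_eq_zero, ← coe_eq_empty]
  exact Set.subset_eq_empty h hs

theorem chainNumber_Ioi_lt {i j : α} (hij : i < j) :
    chainNumber (Set.Ioi j) < chainNumber (Set.Ioi i) := by
  obtain ⟨C, hC, hsub, hcard⟩ := exists_card_eq_chainNumber (Set.Ioi j)
  have hj : j ∉ C := fun h => lt_irrefl j (hsub h)
  rw [← hcard, ← Nat.succ_le_iff, Nat.succ_eq_add_one, ← card_insert_of_notMem hj]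
  refine card_le_chainNumber ?_ ?_
  · rw [coe_insert]
    exact hC.insert fun b hb _ => Or.inl (hsub hb)
  · rw [coe_insert, Set.insert_subset_iff]
    exact ⟨hij, fun b hb => hij.trans (hsub hb)⟩

theorem chainNumber_add_card_of_wcovBy {l : ℕ}
    (hchain : ∀ C : Finset α, IsChain (· < ·) (C : Set α) →
      (∀ D : Finset α, IsChain (· < ·) (D : Set α) → C ⊆ D → C = D) → C.card = l + 1)
    {i j : α} (hij : i ⩿ j) :
    chainNumber (Set.Iio i) + ({i, j} : Finset α).card + chainNumber (Set.Ioi j) = l + 1 := by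
  obtain ⟨A, hA, hAs, hAc⟩ := exists_card_eq_chainNumber (Set.Iio i)
  obtain ⟨B, hB, hBs, hBc⟩ := exists_card_eq_chainNumber (Set.Ioi j)
  have hA' : ∀ x ∈ A, x < i := fun x hx => hAs hx
  have hB' : ∀ x ∈ B, j < x := fun x hx => hBs hx
  have hle := hij.le
  have hd1 : Disjoint A {i, j} := by
    rw [disjoint_left]
    intro x hx hx'
    rcases mem_insert.1 hx' with rfl | hx'
    · exact lt_irrefl _ (hA' _ hx)
    · rw [mem_singleton] at hx'
      subst hx'
      exact lt_irrefl _ ((hA' _ hx).trans_le hle)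
  have hd2 : Disjoint (A ∪ {i, j}) B := by
    rw [disjoint_left]
    intro x hx hx'
    have h := hB' x hx'
    rcases mem_union.1 hx with hx | hx
    · exact lt_irrefl _ ((hA' _ hx).trans_le (hle.trans h.le))
    · rcases mem_insert.1 hx with rfl | hx
      · exact lt_irrefl _ (h.trans_le hle)
      · rw [mem_singleton] at hx
        subst hx
        exact lt_irrefl _ h
  rw [← hAc, ← hBc, ← card_union_of_disjoint hd1, ← card_union_of_disjoint hd2]
  refine hchain _ ?_ ?_
  · have hpair : IsChain (· < ·) (({i, j} : Finset α) : Set α) := by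
      rw [coe_insert, coe_singleton]
      refine IsChain.insert (Set.Subsingleton.isChain Set.subsingleton_singleton) ?_
      rintro b rfl hne
      exact Or.inl (lt_of_le_of_ne hle hne)
    have hmem : ∀ x ∈ ({i, j} : Finset α), i ≤ x ∧ x ≤ j := by
      intro x hx
      rcases mem_insert.1 hx with rfl | hx
      · exact ⟨le_rfl, hle⟩
      · rw [mem_singleton] at hx
        subst hx
        exact ⟨hle, le_rfl⟩
    intro x hx y hy hne
    simp only [coe_union, Set.mem_union, mem_coe] at hx hy
    rcases hx with (hx | hx) | hx <;> rcases hy with (hy | hy) | hy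
    · exact hA hx hy hne
    · exact Or.inl ((hA' x hx).trans_le (hmem y hy).1)
    · exact Or.inl ((hA' x hx).trans_le (hle.trans (hB' y hy).le))
    · exact Or.inr ((hA' y hy).trans_le (hmem x hx).1)
    · exact hpair hx hy hne
    · exact Or.inl ((hmem x hx).2.trans_lt (hB' y hy))
    · exact Or.inr ((hA' y hy).trans_le (hle.trans (hB' x hx).le))
    · exact Or.inr ((hmem y hy).2.trans_lt (hB' x hx))
    · exact hB hx hy hne
  · intro D hD hsub
    refine eq_of_subset_of_card_le hsub ?_
    have hiD : i ∈ D := hsub (by simp)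
    have hjD : j ∈ D := hsub (by simp)
    have hcover : D ⊆ (D.filter (· < i) ∪ {i, j}) ∪ D.filter (j < ·) := by
      intro x hx
      simp only [mem_union, mem_filter, mem_insert, mem_singleton]
      by_cases hxi : x = i
      · exact Or.inl (Or.inr (Or.inl hxi))
      by_cases hxj : x = j
      · exact Or.inl (Or.inr (Or.inr hxj))
      rcases hD hx hiD hxi with h | h
      · exact Or.inl (Or.inl ⟨hx, h⟩)
      · rcases hD hx hjD hxj with h' | h'
        · exact absurd h' (hij.2 h)
        · exact Or.inr ⟨hx, h'⟩
    have h1 : (D.filter (· < i)).card ≤ A.card := by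
      rw [hAc]
      exact card_le_chainNumber (hD.mono (coe_subset.2 (filter_subset _ _)))
        fun x hx => (mem_filter.1 hx).2
    have h2 : (D.filter (j < ·)).card ≤ B.card := by
      rw [hBc]
      exact card_le_chainNumber (hD.mono (coe_subset.2 (filter_subset _ _)))
        fun x hx => (mem_filter.1 hx).2
    have h3 := (card_le_card hcover).trans (card_union_le _ _)
    have h4 := card_union_le (D.filter (· < i)) {i, j}
    rw [card_union_of_disjoint hd2, card_union_of_disjoint hd1]
    omega

theorem sub_chainNumber_le {l : ℕ}
    (hchain : ∀ C : Finset α, IsChain (· < ·) (C : Set α) →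
      (∀ D : Finset α, IsChain (· < ·) (D : Set α) → C ⊆ D → C = D) → C.card = l + 1)
    {σ : α → ℕ} (hσ : StrictAnti σ) {i j : α} (hij : i ≤ j) :
    (σ j : ℤ) - chainNumber (Set.Ioi j) ≤ (σ i : ℤ) - chainNumber (Set.Ioi i) := by
  let : LocallyFiniteOrder α := Fintype.toLocallyFiniteOrder
  have h : Antitone fun i => (σ i : ℤ) - chainNumber (Set.Ioi i) := by
    rw [antitone_iff_forall_covBy]
    intro a b hab
    have h1 := chainNumber_add_card_of_wcovBy hchain hab.wcovBy
    have h2 := chainNumber_add_card_of_wcovBy hchain (WCovBy.refl a)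
    have h3 := hσ hab.lt
    rw [card_pair hab.lt.ne] at h1
    simp only [pair_eq_singleton, card_singleton] at h2
    omega
  exact h hij

theorem chainNumber_Ioi_le {l : ℕ}
    (hchain : ∀ C : Finset α, IsChain (· < ·) (C : Set α) →
      (∀ D : Finset α, IsChain (· < ·) (D : Set α) → C ⊆ D → C = D) → C.card = l + 1)
    (i : α) : chainNumber (Set.Ioi i) ≤ l := by
  have h := chainNumber_add_card_of_wcovBy hchain (WCovBy.refl i)
  simp only [pair_eq_singleton, card_singleton] at h
  omega

theorem chainNumber_le_of_strictAnti {l : ℕ}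
    (hchain : ∀ C : Finset α, IsChain (· < ·) (C : Set α) →
      (∀ D : Finset α, IsChain (· < ·) (D : Set α) → C ⊆ D → C = D) → C.card = l + 1)
    {σ : α → ℕ} (hσ : StrictAnti σ) (i : α) : chainNumber (Set.Ioi i) ≤ σ i := by
  obtain ⟨j, hij, hj⟩ := Finite.exists_le_maximal (p := fun _ : α => True) (a := i) trivial
  have h0 : chainNumber (Set.Ioi j) = 0 :=
    chainNumber_eq_zero (Set.eq_empty_of_forall_notMem fun x hx =>
      lt_irrefl j (lt_of_lt_of_le hx (hj.2 trivial (le_of_lt hx))))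
  have := sub_chainNumber_le hchain hσ hij
  omega

theorem sub_chainNumber_lt {l n : ℕ}
    (hchain : ∀ C : Finset α, IsChain (· < ·) (C : Set α) →
      (∀ D : Finset α, IsChain (· < ·) (D : Set α) → C ⊆ D → C = D) → C.card = l + 1)
    {σ : α → ℕ} (hσ : StrictAnti σ) (hn : ∀ i, σ i < n) (i : α) :
    σ i - chainNumber (Set.Ioi i) < n - l := by
  obtain ⟨j, hij, hj⟩ := Finite.exists_le_minimal (p := fun _ : α => True) (a := i) trivial
  have h0 : chainNumber (Set.Iio j) = 0 :=
    chainNumber_eq_zero (Set.eq_empty_of_forall_notMem fun x hx =>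
      lt_irrefl j (lt_of_le_of_lt (hj.2 trivial (le_of_lt hx)) hx))
  have h1 := chainNumber_add_card_of_wcovBy hchain (WCovBy.refl j)
  simp only [pair_eq_singleton, card_singleton] at h1
  have h2 := sub_chainNumber_le hchain hσ hij
  have h3 := chainNumber_le_of_strictAnti hchain hσ i
  have h4 := chainNumber_le_of_strictAnti hchain hσ j
  have h5 := hn j
  omega

theorem card_strictAnti_eq_card_antitone [DecidableEq α] {l : ℕ}
    (hchain : ∀ C : Finset α, IsChain (· < ·) (C : Set α) →
      (∀ D : Finset α, IsChain (· < ·) (D : Set α) → C ⊆ D → C = D) → C.card = l + 1)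
    (n : ℕ) :
    (univ.filter fun σ : α → Fin n => StrictAnti σ).card =
      (univ.filter fun τ : α → Fin (n - l) => Antitone τ).card := by
  refine Finset.card_bij'
    (fun σ hσ i => ⟨σ i - chainNumber (Set.Ioi i),
      sub_chainNumber_lt (σ := fun i => (σ i : ℕ)) hchain
        (fun _ _ h => (mem_filter.1 hσ).2 h) (fun i => (σ i).isLt) i⟩)
    (fun τ _ i => ⟨τ i + chainNumber (Set.Ioi i), by
      have := chainNumber_Ioi_le hchain i
      have := (τ i).isLt
      omega⟩) ?_ ?_ ?_ ?_
  · intro σ hσ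
    rw [mem_filter]
    refine ⟨mem_univ _, fun i j hij => ?_⟩
    have h := sub_chainNumber_le (σ := fun i => (σ i : ℕ)) hchain
      (fun _ _ h => (mem_filter.1 hσ).2 h) hij
    rw [Fin.le_def]
    dsimp only at h ⊢
    omega
  · intro τ hτ
    rw [mem_filter]
    refine ⟨mem_univ _, fun i j hij => ?_⟩
    have h1 := chainNumber_Ioi_lt hij
    have h2 := (mem_filter.1 hτ).2 hij.le
    rw [Fin.le_def] at h2
    rw [Fin.lt_def]
    dsimp only
    omega
  · intro σ hσ
    ext i
    exact Nat.sub_add_cancel (chainNumber_le_of_strictAnti (σ := fun i => (σ i : ℕ)) hchain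
      (fun _ _ h => (mem_filter.1 hσ).2 h) i)
  · intro τ _
    ext i
    simp

end Chains

theorem map_eq_map_of_sum_choose_eq {ι : Type*} (T : Finset ι) (f g : ι → ℕ) (q : ℕ)
    (h : ∀ n : ℕ, ∑ i ∈ T, (n + q - f i).choose (q + 1) =
      ∑ i ∈ T, (n + q - g i).choose (q + 1)) :
    T.val.map f = T.val.map g := by
  have hsum : ∀ (e : ι → ℕ) (t : ℕ), ∑ i ∈ T, (t + 1 + q - e i).choose (q + 1) =
      ∑ s ∈ range (t + 1), (T.filter (e · = s)).card * (t + 1 + q - s).choose (q + 1) := by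
    intro e t
    have h0 : ∑ i ∈ T, (t + 1 + q - e i).choose (q + 1) =
        ∑ i ∈ T.filter (e · ∈ range (t + 1)), (t + 1 + q - e i).choose (q + 1) := by
      rw [sum_filter_of_ne]
      intro i _ hne
      rw [mem_range]
      by_contra hlt
      exact hne (Nat.choose_eq_zero_of_lt (by omega))
    rw [h0, ← sum_fiberwise_of_maps_to (g := e) (t := range (t + 1))
      (fun i hi => (mem_filter.1 hi).2)]
    refine sum_congr rfl fun s hs => ?_
    rw [filter_filter, ← smul_eq_mul, ← sum_const]
    refine sum_congr ?_ fun i hi => by rw [(mem_filter.1 hi).2]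
    ext i
    simp only [mem_filter]
    constructor
    · rintro ⟨h1, -, h2⟩
      exact ⟨h1, h2⟩
    · rintro ⟨h1, h2⟩
      exact ⟨h1, h2 ▸ hs, h2⟩
  have key : ∀ t, (T.filter (f · = t)).card = (T.filter (g · = t)).card := by
    intro t
    induction t using Nat.strong_induction_on with
    | _ t ih =>
      have ht := h (t + 1)
      rw [hsum, hsum, sum_range_succ, sum_range_succ,
        sum_congr rfl fun s hs => by rw [ih s (mem_range.1 hs)]] at ht
      have h1 : t + 1 + q - t = q + 1 := by omega
      rw [h1, Nat.choose_self, mul_one, mul_one] at ht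
      exact Nat.add_left_cancel ht
  ext t
  rw [Multiset.count_map, Multiset.count_map]
  have := key t
  simp only [Finset.card, filter_val] at this
  simpa only [eq_comm] using this

theorem prod_range_sub_reflect (q : ℕ) (y : ℚ) :
    ∏ i ∈ range (q + 1), ((q : ℚ) - y - i) =
      (-1) ^ (q + 1) * ∏ i ∈ range (q + 1), (y - i) := by
  rw [← prod_range_reflect, ← card_range (q + 1), ← prod_const, card_range, ← prod_mul_distrib]
  refine prod_congr rfl fun i hi => ?_
  rw [Nat.add_sub_cancel, Nat.cast_sub (Nat.lt_succ_iff.1 (mem_range.1 hi))]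
  ring

theorem exists_polynomial_of_map_eq {ι : Type*} (T : Finset ι) (d : ι → ℕ) (q l : ℕ)
    (hd : ∀ i ∈ T, d i ≤ q) (hmap : T.val.map (fun i => q - d i) = T.val.map (fun i => d i + l)) :
    ∃ f : Polynomial ℚ,
      (∀ m : ℕ, f.eval (m : ℚ) = ((∑ i ∈ T, (m + (q - d i)).choose (q + 1) : ℕ) : ℚ)) ∧
      f = Polynomial.C ((-1 : ℚ) ^ (q + 1)) *
        f.comp (-Polynomial.C (l : ℚ) - Polynomial.X) := by
  refine ⟨Polynomial.C (((q + 1).factorial : ℚ)⁻¹) * ∑ i ∈ T, ∏ k ∈ range (q + 1),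
    (Polynomial.X + Polynomial.C (((q - d i : ℕ) : ℚ)) - Polynomial.C (k : ℚ)),
    fun m => ?_, Polynomial.funext fun x => ?_⟩
  · simp only [Polynomial.eval_mul, Polynomial.eval_C, Polynomial.eval_finsetSum,
      Polynomial.eval_prod, Polynomial.eval_sub, Polynomial.eval_add, Polynomial.eval_X]
    rw [inv_mul_eq_iff_eq_mul₀ (by positivity), Nat.cast_sum, mul_sum]
    refine sum_congr rfl fun i _ => ?_
    rw [← descPochhammer_eval_eq_prod_range, ← Nat.cast_add,
      descPochhammer_eval_eq_descFactorial, Nat.descFactorial_eq_factorial_mul_choose,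
      Nat.cast_mul]
  · simp only [Polynomial.eval_mul, Polynomial.eval_C, Polynomial.eval_comp,
      Polynomial.eval_finsetSum, Polynomial.eval_prod, Polynomial.eval_sub, Polynomial.eval_add,
      Polynomial.eval_X, Polynomial.eval_neg]
    have h1 : ∑ i ∈ T, ∏ k ∈ range (q + 1), (x + ((q - d i : ℕ) : ℚ) - k) =
        ∑ i ∈ T, ∏ k ∈ range (q + 1), (x + ((d i + l : ℕ) : ℚ) - k) := by
      have := congrArg (fun M : Multiset ℕ =>
        (M.map fun e : ℕ => ∏ k ∈ range (q + 1), (x + (e : ℚ) - k)).sum) hmap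
      simp only [Multiset.map_map, Function.comp_def] at this
      exact this
    rw [h1, mul_left_comm, mul_sum T _ ((-1 : ℚ) ^ (q + 1))]
    congr 1
    refine sum_congr rfl fun i hi => ?_
    have h2 : -(l : ℚ) - x + ((q - d i : ℕ) : ℚ) = q - (x + ((d i + l : ℕ) : ℚ)) := by
      rw [Nat.cast_sub (hd i hi)]
      push_cast
      ring
    rw [h2, prod_range_sub_reflect, ← mul_assoc, ← mul_pow]
    simp

/-- The number of descents of `π`, indexed by pairs of consecutive positions. -/
noncomputable def descents {q : ℕ} (π : Equiv.Perm (Fin (q + 1))) : ℕ :=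
  (univ.filter fun k : Fin q => π k.succ < π k.castSucc).card

theorem descents_le {q : ℕ} (π : Equiv.Perm (Fin (q + 1))) : descents π ≤ q :=
  (card_filter_le _ _).trans (by simp)

theorem card_desSet {q : ℕ} (π : Equiv.Perm (Fin (q + 1))) :
    (desSet (q + 1) fun k => (π k : ℕ)).card = descents π := by
  symm
  refine Finset.card_bij (fun k _ => (k : ℕ) + 1) ?_ ?_ ?_
  · intro k hk
    have hk' := (mem_filter.1 hk).2
    rw [desSet, mem_filter, mem_Ico]
    have := k.isLt
    exact ⟨⟨by omega, by omega⟩, by simp only [Nat.add_sub_cancel]; omega,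
      by omega, hk'⟩
  · intro a _ b _ hab
    exact Fin.ext (Nat.succ_injective hab)
  · intro b hb
    rw [desSet, mem_filter, mem_Ico] at hb
    obtain ⟨⟨hb1, hb2⟩, h1, h2, h3⟩ := hb
    obtain ⟨c, rfl⟩ : ∃ c, b = c + 1 := ⟨b - 1, by omega⟩
    exact ⟨⟨c, by omega⟩, mem_filter.2 ⟨mem_univ _, h3⟩, rfl⟩

theorem ascents_neg {q : ℕ} (π : Equiv.Perm (Fin (q + 1))) :
    ascents ((fun i : Fin (q + 1) => -((i : ℕ) : ℤ)) ∘ π) = descents π := by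
  unfold ascents descents
  congr 1
  ext k
  simp

theorem ascents_cast {q : ℕ} (π : Equiv.Perm (Fin (q + 1))) :
    ascents ((fun i : Fin (q + 1) => ((i : ℕ) : ℤ)) ∘ π) = q - descents π := by
  have h : ascents ((fun i : Fin (q + 1) => ((i : ℕ) : ℤ)) ∘ π) + descents π = q := by
    have h1 := card_filter_add_card_filter_not (s := (univ : Finset (Fin q)))
      (fun k => π k.castSucc < π k.succ)
    rw [card_univ, Fintype.card_fin] at h1
    refine Eq.trans ?_ h1
    unfold ascents descents
    congr 2
    · ext k
      simp
    · ext k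
      have hne : π k.succ ≠ π k.castSucc := fun h =>
        (Fin.castSucc_lt_succ (i := k)).ne' (π.injective h)
      simp only [mem_filter, mem_univ, true_and, not_lt]
      exact ⟨le_of_lt, fun h => lt_of_le_of_ne h hne⟩
  omega

theorem orderPolyVal_eq_sum {q : ℕ} (P : PartialOrder (Fin (q + 1))) (m : ℕ) :
    orderPolyVal (q + 1) P m =
      ∑ π : Equiv.Perm (Fin (q + 1)) with IsLinExt (q + 1) P π,
        (m + (q - descents π)).choose (q + 1) := by
  simp only [← ascents_cast]
  rw [← card_isLabeledPartition P (fun i => ((i : ℕ) : ℤ))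
    (fun i j h => Fin.ext (Int.ofNat_injective h))]
  unfold orderPolyVal
  congr 1
  ext σ
  simp [IsPPartition, IsLabeledPartition]

theorem card_strictAnti_eq_sum {q : ℕ} (P : PartialOrder (Fin (q + 1)))
    (hnat : ∀ i j, P.lt i j → @LT.lt _ instLTFin i j) (m : ℕ) :
    (univ.filter fun σ : Fin (q + 1) → Fin m =>
      @StrictAnti (Fin (q + 1)) (Fin m) P.toPreorder _ σ).card =
      ∑ π : Equiv.Perm (Fin (q + 1)) with IsLinExt (q + 1) P π,
        (m + descents π).choose (q + 1) := by
  simp only [← ascents_neg]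
  rw [← card_isLabeledPartition P (fun i => -((i : ℕ) : ℤ))
    (fun i j h => Fin.ext (Int.ofNat_injective (neg_injective h)))]
  congr 1
  ext σ
  simp only [mem_filter, mem_univ, true_and]
  constructor
  · intro h i j hij
    exact ⟨le_of_lt (h hij), fun _ => h hij⟩
  · intro h i j hij
    exact (h i j hij).2 (neg_lt_neg (Int.ofNat_lt.2 (hnat i j hij)))

theorem orderPolyVal_eq_card_antitone {p : ℕ} (P : PartialOrder (Fin p))
    (hnat : ∀ i j, P.lt i j → @LT.lt _ instLTFin i j) (m : ℕ) :
    orderPolyVal p P m = (univ.filter fun σ : Fin p → Fin m =>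
      @Antitone (Fin p) (Fin m) P.toPreorder _ σ).card := by
  unfold orderPolyVal
  congr 1
  ext σ
  simp only [mem_filter, mem_univ, true_and]
  constructor
  · intro h i j hij
    rcases (@le_iff_lt_or_eq _ P _ _).1 hij with hlt | rfl
    · exact (h i j hlt).1
    · exact le_rfl
  · intro h i j hij
    refine ⟨h (@le_of_lt _ P.toPreorder _ _ hij), fun hji => ?_⟩
    exact absurd (hnat i j hij) (Fin.lt_asymm hji)

theorem map_descents_eq {q l : ℕ} (P : PartialOrder (Fin (q + 1)))
    (hnat : ∀ i j, P.lt i j → @LT.lt _ instLTFin i j)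
    (hchain : ∀ C : Finset (Fin (q + 1)), IsChain P.lt (C : Set (Fin (q + 1))) →
      (∀ D : Finset (Fin (q + 1)), IsChain P.lt (D : Set (Fin (q + 1))) → C ⊆ D → C = D) →
      C.card = l + 1) :
    (univ.filter fun π => IsLinExt (q + 1) P π).val.map (fun π => q - descents π) =
      (univ.filter fun π => IsLinExt (q + 1) P π).val.map (fun π => descents π + l) := by
  refine map_eq_map_of_sum_choose_eq _ _ _ q fun n => ?_
  have h : (univ.filter fun σ : Fin (q + 1) → Fin n =>
      @StrictAnti (Fin (q + 1)) (Fin n) P.toPreorder _ σ).card =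
      (univ.filter fun σ : Fin (q + 1) → Fin (n - l) =>
        @Antitone (Fin (q + 1)) (Fin (n - l)) P.toPreorder _ σ).card := by
    convert @card_strictAnti_eq_card_antitone _ P _ _ l hchain n
  rw [card_strictAnti_eq_sum P hnat, ← orderPolyVal_eq_card_antitone P hnat,
    orderPolyVal_eq_sum] at h
  convert h using 2 with π _ π _
  · have := descents_le π
    congr 1
    omega
  · have := descents_le π
    rcases le_or_gt l n with hl | hl
    · congr 1
      omega
    · rw [Nat.choose_eq_zero_of_lt (by omega), Nat.choose_eq_zero_of_lt (by omega)]

theorem card_filter_descents_eq {q l : ℕ} (T : Finset (Equiv.Perm (Fin (q + 1))))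
    (hmap : T.val.map (fun π => q - descents π) = T.val.map (fun π => descents π + l)) (s : ℤ) :
    (T.filter fun π => (descents π : ℤ) = s).card =
      (T.filter fun π => (descents π : ℤ) = q - l - s).card := by
  rcases lt_or_ge ((l : ℤ) + s) 0 with hs | hs
  · rw [filter_false_of_mem fun π _ => by omega, filter_false_of_mem fun π _ => by
      have := descents_le π
      omega]
  · obtain ⟨t, ht⟩ := Int.eq_ofNat_of_zero_le hs
    have h := congrArg (Multiset.count t) hmap
    rw [Multiset.count_map, Multiset.count_map, ← filter_val, ← filter_val] at h
    refine Eq.trans ?_ (h.symm.trans ?_)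
    · refine congrArg card (filter_congr fun π _ => ?_)
      omega
    · refine congrArg card (filter_congr fun π _ => ?_)
      have := descents_le π
      omega

end OrderPolynomial

/-- **Stanley, Proposition 19.3** : if `P` is naturally labeled and every maximal
chain of `P` has exactly `l + 1` elements, then (a) for every `s` the number of
linear extensions with `s` descents equals the number with `p − 1 − l − s`
descents, and (b) the order polynomial `f` satisfies `f(X) = (−1)^p f(−l−X)`. -/
theorem stanley_chain_condition (p : ℕ) (hp : 0 < p) (P : PartialOrder (Fin p))
    (l : ℕ) (hnat : ∀ i j : Fin p, P.lt i j → i < j)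
    (hchain : ∀ C : Finset (Fin p), IsChain P.lt (C : Set (Fin p)) →
      (∀ D : Finset (Fin p), IsChain P.lt (D : Set (Fin p)) → C ⊆ D → C = D) →
      C.card = l + 1) :
    (∀ s : ℤ,
      (Finset.univ.filter (fun π : Equiv.Perm (Fin p) =>
          IsLinExt p P π ∧ ((desSet p fun k => (π k : ℕ)).card : ℤ) = s)).card =
      (Finset.univ.filter (fun π : Equiv.Perm (Fin p) =>
          IsLinExt p P π ∧
            ((desSet p fun k => (π k : ℕ)).card : ℤ) = (p : ℤ) - 1 - l - s)).card) ∧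
    (∃ f : Polynomial ℚ,
      (∀ m : ℕ, f.eval (m : ℚ) = orderPolyVal p P m) ∧
      f = Polynomial.C ((-1 : ℚ) ^ p) *
        f.comp (-Polynomial.C (l : ℚ) - Polynomial.X)) := by

  obtain ⟨q, rfl⟩ : ∃ q, p = q + 1 := ⟨p - 1, by omega⟩
  have hmap := OrderPolynomial.map_descents_eq P hnat hchain
  refine ⟨fun s => ?_, ?_⟩
  · have h := OrderPolynomial.card_filter_descents_eq _ hmap s
    rw [Finset.filter_filter, Finset.filter_filter] at h
    simp only [OrderPolynomial.card_desSet]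
    rw [h]
    push_cast
    rw [add_sub_cancel_right]
  · obtain ⟨f, hf, hsymm⟩ := OrderPolynomial.exists_polynomial_of_map_eq _
      OrderPolynomial.descents q l (fun π _ => OrderPolynomial.descents_le π) hmap
    refine ⟨f, fun m => ?_, hsymm⟩
    rw [hf, OrderPolynomial.orderPolyVal_eq_sum]
end

section
/- (Kreweras.) Let Y = (y₁ ≥ ⋯ ≥ y_h) and Y' = (y'₁ ≥ ⋯ ≥ y'_h) be weakly decreasing h-tuples of nonnegative integers with y'_i ≤ y_i for all i, and let m = ∑_i y_i − ∑_i y'_i. Then in ℤ[[t]], ∑_{r≥0} θ_r t^r = (1−t)^{m+1} · ∑_{r≥0} w_r t^r, where θ_r is the number of Young chains from Y' to Y with exactly r returns and w_r is the number of multichains Y' ≤ Z₁ ≤ ⋯ ≤ Z_r ≤ Y. -/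
open scoped Classical

/-- `v` is a weakly decreasing `h`-tuple. -/
def IsDecr (h : ℕ) (v : Fin h → ℕ) : Prop := ∀ i j : Fin h, i ≤ j → v j ≤ v i

/-- `V` is a Young chain from `Y'` to `Y` (of length `m`): a sequence of weakly
decreasing tuples starting at `Y'`, ending at `Y`, each obtained from the previous
one by increasing exactly one coordinate by `1`. -/
def IsYoungChain (h : ℕ) (Y' Y : Fin h → ℕ) (m : ℕ)
    (V : Fin (m + 1) → Fin h → ℕ) : Prop :=
  V 0 = Y' ∧ V (Fin.last m) = Y ∧ (∀ k, IsDecr h (V k)) ∧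
    ∀ k : Fin m, ∃ a : Fin h,
      V k.succ = Function.update (V k.castSucc) a (V k.castSucc a + 1)

/-- `V` extended to all natural indices (values beyond `m` are irrelevant). -/
noncomputable def chainAt (h m : ℕ) (Y : Fin h → ℕ)
    (V : Fin (m + 1) → Fin h → ℕ) (k : ℕ) : Fin h → ℕ :=
  if hk : k < m + 1 then V ⟨k, hk⟩ else Y

/-- The number of returns of the Young chain `V`: indices `2 ≤ k ≤ m` such that
the coordinate increased at step `k` is strictly smaller than the coordinate
increased at step `k - 1`. -/
noncomputable def numReturns (h m : ℕ) (Y : Fin h → ℕ)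
    (V : Fin (m + 1) → Fin h → ℕ) : ℕ :=
  ((Finset.Icc 2 m).filter fun k =>
    ∃ i j : Fin h,
      chainAt h m Y V k i = chainAt h m Y V (k - 1) i + 1 ∧
      chainAt h m Y V (k - 1) j = chainAt h m Y V (k - 2) j + 1 ∧
      i < j).card

section

variable {h : ℕ}

/-- The tuple `Y` with its `b`-th coordinate decreased by one. -/
def lowerAt (Y : Fin h → ℕ) (b : Fin h) : Fin h → ℕ := Function.update Y b (Y b - 1)

theorem lowerAt_self (Y : Fin h → ℕ) (b : Fin h) : lowerAt Y b b = Y b - 1 := by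
  simp [lowerAt]

theorem lowerAt_of_ne (Y : Fin h → ℕ) {b i : Fin h} (hi : i ≠ b) : lowerAt Y b i = Y i := by
  simp [lowerAt, hi]

theorem lowerAt_le (Y : Fin h → ℕ) (b : Fin h) : lowerAt Y b ≤ Y := by
  intro i
  by_cases hi : i = b
  · subst hi; simp [lowerAt_self]
  · rw [lowerAt_of_ne Y hi]

theorem sum_lowerAt (Y : Fin h → ℕ) {b : Fin h} (hb : 0 < Y b) :
    ∑ i, lowerAt Y b i + 1 = ∑ i, Y i := by
  have h1 := Finset.add_sum_erase Finset.univ Y (Finset.mem_univ b)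
  have h2 := Finset.add_sum_erase Finset.univ (lowerAt Y b) (Finset.mem_univ b)
  have h3 : ∑ i ∈ Finset.univ.erase b, lowerAt Y b i = ∑ i ∈ Finset.univ.erase b, Y i :=
    Finset.sum_congr rfl fun i hi => lowerAt_of_ne Y (Finset.ne_of_mem_erase hi)
  rw [lowerAt_self] at h2
  omega

theorem update_eq_iff_lowerAt (Y V : Fin h → ℕ) (b : Fin h) :
    Y = Function.update V b (V b + 1) ↔ 0 < Y b ∧ V = lowerAt Y b := by
  constructor
  · rintro rfl
    refine ⟨by simp, ?_⟩
    simp [lowerAt]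
  · rintro ⟨hb, rfl⟩
    funext i
    by_cases hi : i = b
    · subst hi; simp [lowerAt_self]; omega
    · simp [hi, lowerAt_of_ne]

/-- Decreasing tuples between `Y'` and `Y` agreeing with `Y` from the coordinate `a` on. -/
noncomputable def lowerSection (Y' Y : Fin h → ℕ) (a : ℕ) : Finset (Fin h → ℕ) :=
  (Finset.Icc Y' Y).filter fun Z => IsDecr h Z ∧ ∀ i : Fin h, a ≤ i → Z i = Y i

theorem mem_lowerSection {Y' Y Z : Fin h → ℕ} {a : ℕ} :
    Z ∈ lowerSection Y' Y a ↔
      Y' ≤ Z ∧ Z ≤ Y ∧ IsDecr h Z ∧ ∀ i : Fin h, a ≤ i → Z i = Y i := by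
  simp [lowerSection, and_assoc]

/-- Multichains of length `r` of decreasing tuples between `Y'` and `Y`. -/
def multichains (Y' Y : Fin h → ℕ) (r : ℕ) : Set (Fin r → Fin h → ℕ) :=
  {Z | (∀ k, IsDecr h (Z k)) ∧ (∀ k i, Y' i ≤ Z k i) ∧ (∀ k i, Z k i ≤ Y i) ∧
    (∀ k l : Fin r, k ≤ l → ∀ i, Z k i ≤ Z l i)}

theorem multichains_finite (Y' Y : Fin h → ℕ) (r : ℕ) : (multichains Y' Y r).Finite := by
  refine (Set.finite_Icc (fun _ => Y') (fun _ => Y)).subset ?_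
  rintro Z ⟨-, h1, h2, -⟩
  exact ⟨h1, h2⟩

theorem ncard_multichains_zero (Y' Y : Fin h → ℕ) : (multichains Y' Y 0).ncard = 1 := by
  rw [Set.ncard_eq_one]
  refine ⟨Fin.elim0, ?_⟩
  ext Z
  simp [multichains, Subsingleton.elim Z Fin.elim0]

theorem snoc_mem_multichains {Y' Y : Fin h → ℕ} {r : ℕ} {Z : Fin r → Fin h → ℕ}
    {z : Fin h → ℕ} :
    (Fin.snoc Z z : Fin (r + 1) → Fin h → ℕ) ∈ multichains Y' Y (r + 1) ↔
      z ∈ lowerSection Y' Y h ∧ Z ∈ multichains Y' z r := by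
  have hs : ∀ i : Fin h, h ≤ (i : ℕ) → z i = Y i := fun i hi => absurd i.2 (by omega)
  simp only [multichains, Set.mem_ofPred_eq, mem_lowerSection, Fin.forall_fin_succ',
    Fin.snoc_castSucc, Fin.snoc_last, Pi.le_def]
  constructor
  · rintro ⟨⟨h1, h2⟩, ⟨h3, h4⟩, ⟨h5, h6⟩, ⟨h7, h8⟩⟩
    exact ⟨⟨h4, h6, h2, hs⟩, h1, h3, fun k => (h7 k).2 (Fin.le_last _),
      fun k l hkl => (h7 k).1 l (by simpa using hkl)⟩
  · rintro ⟨⟨h4, h6, h2, -⟩, h1, h3, h5, h7⟩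
    refine ⟨⟨h1, h2⟩, ⟨h3, h4⟩, ⟨fun k i => (h5 k i).trans (h6 i), h6⟩,
      fun k => ⟨fun l hkl => h7 k l (by simpa using hkl), fun _ => h5 k⟩,
      fun l hl => absurd hl (by simp [Fin.le_def, l.2]), fun _ _ => le_rfl⟩

theorem ncard_multichains_succ (Y' Y : Fin h → ℕ) (r : ℕ) :
    (multichains Y' Y (r + 1)).ncard =
      ∑ Z ∈ lowerSection Y' Y h, (multichains Y' Z r).ncard := by
  rw [Set.ncard_eq_toFinset_card _ (multichains_finite Y' Y (r + 1)),
    Finset.sum_congr rfl fun Z _ => Set.ncard_eq_toFinset_card _ (multichains_finite Y' Z r),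
    ← Finset.card_sigma]
  symm
  refine Finset.card_nbij (fun p => (Fin.snoc p.2 p.1 : Fin (r + 1) → Fin h → ℕ)) ?_ ?_ ?_
  · rintro ⟨z, Z⟩ hz
    simpa [snoc_mem_multichains] using hz
  · rintro ⟨z, Z⟩ - ⟨z', Z'⟩ - he
    obtain ⟨rfl, rfl⟩ := Fin.snoc_inj.1 he
    rfl
  · intro V hV
    refine ⟨⟨V (Fin.last r), Fin.init V⟩, ?_, Fin.snoc_init_self V⟩
    rw [← Fin.snoc_init_self V] at hV
    simpa only [Finset.coe_sigma, Set.mem_sigma_iff, Set.Finite.coe_toFinset, Finset.mem_coe,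
      snoc_mem_multichains] using hV

/-- The generating series of multichains by length. -/
noncomputable def multichainSeries (Y' Y : Fin h → ℕ) : PowerSeries ℤ :=
  PowerSeries.mk fun r => ((multichains Y' Y r).ncard : ℤ)

/-- Sum over a lower section of the series of multichains having the given element on top. -/
noncomputable def sectionSeries (Y' Y : Fin h → ℕ) (a : ℕ) : PowerSeries ℤ :=
  ∑ Z ∈ lowerSection Y' Y a,
    (PowerSeries.X * multichainSeries Y' Z + if Z = Y' then 1 else 0)

theorem sectionSeries_top {Y' Y : Fin h → ℕ} (hY' : IsDecr h Y') (hle : Y' ≤ Y) :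
    sectionSeries Y' Y h = multichainSeries Y' Y := by
  have hmem : Y' ∈ lowerSection Y' Y h :=
    mem_lowerSection.2 ⟨le_rfl, hle, hY', fun i hi => absurd i.2 (by omega)⟩
  rw [sectionSeries, Finset.sum_add_distrib, Finset.sum_ite_eq' _ _ (fun _ => 1), if_pos hmem,
    ← Finset.mul_sum]
  ext (_ | r)
  · simp [multichainSeries, ncard_multichains_zero]
  · simp [multichainSeries, PowerSeries.coeff_succ_X_mul, ncard_multichains_succ,
      PowerSeries.coeff_one]

theorem lowerSection_zero {Y' Y : Fin h → ℕ} (hY : IsDecr h Y) (hle : Y' ≤ Y) :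
    lowerSection Y' Y 0 = {Y} := by
  ext Z
  rw [mem_lowerSection, Finset.mem_singleton]
  constructor
  · rintro ⟨-, -, -, hZ⟩
    exact funext fun i => hZ i (Nat.zero_le _)
  · rintro rfl
    exact ⟨hle, le_rfl, hY, fun _ _ => rfl⟩

theorem sectionSeries_zero {Y' Y : Fin h → ℕ} (hY : IsDecr h Y) (hle : Y' ≤ Y) :
    sectionSeries Y' Y 0 =
      PowerSeries.X * multichainSeries Y' Y + if Y = Y' then 1 else 0 := by
  simp [sectionSeries, lowerSection_zero hY hle]

theorem sectionSeries_self {Y' : Fin h → ℕ} (hY' : IsDecr h Y') (a : ℕ) :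
    sectionSeries Y' Y' a = PowerSeries.X * multichainSeries Y' Y' + 1 := by
  have : lowerSection Y' Y' a = {Y'} := by
    ext Z
    rw [mem_lowerSection, Finset.mem_singleton]
    exact ⟨fun hZ => le_antisymm hZ.2.1 hZ.1, by rintro rfl; exact ⟨le_rfl, le_rfl, hY', by simp⟩⟩
  simp [sectionSeries, this]

theorem lowerSection_subset_lowerAt {Y' Y Z : Fin h → ℕ} {b : Fin h}
    (hZ : Z ∈ lowerSection Y' Y (b + 1)) (hb : Z b ≠ Y b) :
    0 < Y b ∧ Z ∈ lowerSection Y' (lowerAt Y b) (b + 1) := by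
  obtain ⟨h1, h2, h3, h4⟩ := mem_lowerSection.1 hZ
  have hlt : Z b < Y b := lt_of_le_of_ne (h2 b) hb
  refine ⟨by omega, mem_lowerSection.2 ⟨h1, fun i => ?_, h3, fun i hi => ?_⟩⟩
  · by_cases hi : i = b
    · subst hi; rw [lowerAt_self]; exact Nat.le_sub_one_of_lt hlt
    · rw [lowerAt_of_ne Y hi]; exact h2 i
  · rw [lowerAt_of_ne Y (by rintro rfl; omega)]
    exact h4 i hi

theorem lowerAt_isDecr {Y' Y Z : Fin h → ℕ} {b : Fin h} (hY : IsDecr h Y)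
    (hZ : Z ∈ lowerSection Y' (lowerAt Y b) (b + 1)) : IsDecr h (lowerAt Y b) := by
  obtain ⟨-, h2, h3, h4⟩ := mem_lowerSection.1 hZ
  intro i j hij
  by_cases hj : (b : ℕ) + 1 ≤ j
  · rw [← h4 j hj]
    exact (h3 i j hij).trans (h2 i)
  · by_cases hi : i = b
    · have : j = i := by subst hi; exact le_antisymm (Fin.le_def.2 (by omega)) hij
      rw [this]
    · rw [lowerAt_of_ne Y hi]
      exact (lowerAt_le Y b j).trans (hY i j hij)

theorem lowerSection_succ {Y' Y : Fin h → ℕ} {b : Fin h} (hb : 0 < Y b) :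
    lowerSection Y' Y (b + 1) =
      lowerSection Y' Y b ∪ lowerSection Y' (lowerAt Y b) (b + 1) := by
  ext Z
  rw [Finset.mem_union]
  constructor
  · intro hZ
    by_cases he : Z b = Y b
    · obtain ⟨h1, h2, h3, h4⟩ := mem_lowerSection.1 hZ
      refine Or.inl (mem_lowerSection.2 ⟨h1, h2, h3, fun i hi => ?_⟩)
      by_cases hi' : i = b
      · rw [hi', he]
      · exact h4 i (by have := Fin.val_ne_of_ne hi'; omega)
    · exact Or.inr (lowerSection_subset_lowerAt hZ he).2
  · rintro (hZ | hZ) <;> obtain ⟨h1, h2, h3, h4⟩ := mem_lowerSection.1 hZ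
    · exact mem_lowerSection.2 ⟨h1, h2, h3, fun i hi => h4 i (by omega)⟩
    · refine mem_lowerSection.2 ⟨h1, h2.trans (lowerAt_le Y b), h3, fun i hi => ?_⟩
      rw [h4 i hi, lowerAt_of_ne Y (by rintro rfl; omega)]

theorem sectionSeries_succ {Y' Y : Fin h → ℕ} {b : Fin h} (hb : 0 < Y b) :
    sectionSeries Y' Y (b + 1) =
      sectionSeries Y' Y b + sectionSeries Y' (lowerAt Y b) (b + 1) := by
  rw [sectionSeries, lowerSection_succ hb, Finset.sum_union]
  · rfl
  · refine Finset.disjoint_left.2 fun Z h1 h2 => ?_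
    have e1 := (mem_lowerSection.1 h1).2.2.2 b le_rfl
    have e2 : Z b ≤ lowerAt Y b b := (mem_lowerSection.1 h2).2.1 b
    rw [lowerAt_self] at e2
    omega

theorem sectionSeries_succ_of_eq_zero {Y' Y : Fin h → ℕ} {b : Fin h} (hb : Y b = 0) :
    sectionSeries Y' Y (b + 1) = sectionSeries Y' Y b := by
  have : lowerSection Y' Y (b + 1) = lowerSection Y' Y b := by
    ext Z
    simp only [mem_lowerSection]
    refine and_congr_right fun _ => and_congr_right fun h2 => and_congr_right fun _ =>
      ⟨fun h4 i hi => ?_, fun h4 i hi => h4 i (by omega)⟩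
    by_cases hi' : i = b
    · have hZ : Z b ≤ Y b := h2 b
      rw [hi']; omega
    · exact h4 i (by have := Fin.val_ne_of_ne hi'; omega)
  rw [sectionSeries, this, sectionSeries]

/-- The generating series, by number of returns, of the Young chains of length `m` from `Y'`
to `Y` whose last step (if any) increases a coordinate with index less than `a`. -/
noncomputable def returnSeries (Y' : Fin h → ℕ) : ℕ → (Fin h → ℕ) → ℕ → PowerSeries ℤ
  | 0, Y, _ => if Y = Y' then 1 else 0
  | m + 1, Y, a =>
    if IsDecr h Y then
      ∑ b : Fin h with b.val < a ∧ 0 < Y b,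
        (PowerSeries.X * returnSeries Y' m (lowerAt Y b) h +
          (1 - PowerSeries.X) * returnSeries Y' m (lowerAt Y b) (b + 1))
    else 0

theorem returnSeries_eq_zero {Y' : Fin h → ℕ} (hY' : IsDecr h Y') :
    ∀ (m : ℕ) (Y : Fin h → ℕ) (a : ℕ), ¬ (IsDecr h Y ∧ Y' ≤ Y) → returnSeries Y' m Y a = 0
  | 0, Y, a, hn => by
    rw [returnSeries, if_neg]
    rintro rfl
    exact hn ⟨hY', le_rfl⟩
  | m + 1, Y, a, hn => by
    rw [returnSeries]
    split_ifs with hd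
    · refine Finset.sum_eq_zero fun b _ => ?_
      have hn' : ¬ (IsDecr h (lowerAt Y b) ∧ Y' ≤ lowerAt Y b) := fun hc =>
        hn ⟨hd, hc.2.trans (lowerAt_le Y b)⟩
      simp [returnSeries_eq_zero hY' m _ _ hn']
    · rfl

theorem returnSeries_succ_succ (Y' : Fin h → ℕ) {Y : Fin h → ℕ} (hY : IsDecr h Y) (m : ℕ)
    (b : Fin h) :
    returnSeries Y' (m + 1) Y (b + 1) = returnSeries Y' (m + 1) Y b +
      if 0 < Y b then PowerSeries.X * returnSeries Y' m (lowerAt Y b) h +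
          (1 - PowerSeries.X) * returnSeries Y' m (lowerAt Y b) (b + 1) else 0 := by
  rw [returnSeries, if_pos hY, returnSeries, if_pos hY]
  have hs : ({c : Fin h | c.val < b.val + 1 ∧ 0 < Y c} : Finset (Fin h)) =
      ({c : Fin h | c.val < b.val ∧ 0 < Y c} : Finset (Fin h)) ∪
        (if 0 < Y b then {b} else ∅) := by
    ext c
    by_cases hc : c = b
    · subst hc; split_ifs with hb <;> simp [hb]
    · have := Fin.val_ne_of_ne hc
      have h2 : c ∉ (if 0 < Y b then {b} else ∅ : Finset (Fin h)) := by
        split_ifs <;> simp [hc]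
      simp only [Finset.mem_union, Finset.mem_filter, Finset.mem_univ, true_and, h2, or_false]
      exact and_congr_left fun _ => by omega
  rw [hs, Finset.sum_union]
  · split_ifs <;> simp
  · split_ifs <;> simp

theorem returnSeries_eq {Y' : Fin h → ℕ} (hY' : IsDecr h Y') :
    ∀ (m : ℕ) (Y : Fin h → ℕ), IsDecr h Y → Y' ≤ Y → ∑ i, Y i = ∑ i, Y' i + m →
      ∀ a ≤ h, returnSeries Y' m Y a =
        (1 - PowerSeries.X) ^ m *
          (sectionSeries Y' Y a - PowerSeries.X * multichainSeries Y' Y)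
  | 0, Y, hY, hle, hsum, a, ha => by
    have : Y = Y' := by
      by_contra hne
      have : ∑ i, Y' i < ∑ i, Y i :=
        Fintype.sum_strictMono (lt_of_le_of_ne hle (Ne.symm hne))
      omega
    subst this
    simp [returnSeries, sectionSeries_self hY']
  | m + 1, Y, hY, hle, hsum, 0, ha => by
    have : Y ≠ Y' := by rintro rfl; omega
    simp [returnSeries, sectionSeries_zero hY hle, this]
  | m + 1, Y, hY, hle, hsum, a + 1, ha => by
    have ih := returnSeries_eq hY' (m + 1) Y hY hle hsum a (by omega)
    obtain ⟨b, rfl⟩ : ∃ b : Fin h, b.val = a := ⟨⟨a, ha⟩, rfl⟩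
    rw [returnSeries_succ_succ Y' hY, ih]
    split_ifs with hb
    · rw [sectionSeries_succ hb]
      by_cases hc : IsDecr h (lowerAt Y b) ∧ Y' ≤ lowerAt Y b
      · have hs := sum_lowerAt Y hb
        have ih' := returnSeries_eq hY' m (lowerAt Y b) hc.1 hc.2 (by omega)
        rw [ih' h le_rfl, ih' _ ha, sectionSeries_top hY' hc.2]
        ring
      · rw [returnSeries_eq_zero hY' m _ _ hc, returnSeries_eq_zero hY' m _ _ hc]
        have : lowerSection Y' (lowerAt Y b) (b + 1) = ∅ := by
          refine Finset.eq_empty_of_forall_notMem fun Z hZ => hc ⟨lowerAt_isDecr hY hZ, ?_⟩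
          exact (mem_lowerSection.1 hZ).1.trans (mem_lowerSection.1 hZ).2.1
        simp [sectionSeries, this]
    · rw [sectionSeries_succ_of_eq_zero (by omega), add_zero]

theorem returnSeries_top {Y' Y : Fin h → ℕ} (hY' : IsDecr h Y') (hY : IsDecr h Y)
    (hle : Y' ≤ Y) {m : ℕ} (hsum : ∑ i, Y i = ∑ i, Y' i + m) :
    returnSeries Y' m Y h = (1 - PowerSeries.X) ^ (m + 1) * multichainSeries Y' Y := by
  rw [returnSeries_eq hY' m Y hY hle hsum h le_rfl, sectionSeries_top hY' hle]
  ring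

/-- Young chains of length `m` whose last step (if any) increases a coordinate with index less
than `a`. -/
def youngChains (Y' Y : Fin h → ℕ) (m a : ℕ) : Set (Fin (m + 1) → Fin h → ℕ) :=
  {V | IsYoungChain h Y' Y m V ∧
    ∀ i : Fin h, a ≤ i → chainAt h m Y V m i = chainAt h m Y V (m - 1) i}

theorem IsYoungChain.castSucc_le_succ {Y' Y : Fin h → ℕ} {m : ℕ} {V : Fin (m + 1) → Fin h → ℕ}
    (hV : IsYoungChain h Y' Y m V) (k : Fin m) : V k.castSucc ≤ V k.succ := by
  obtain ⟨b, hb⟩ := hV.2.2.2 k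
  rw [hb, le_update_iff]
  exact ⟨Nat.le_succ _, fun _ _ => le_rfl⟩

theorem finite_setOf_isYoungChain (Y' Y : Fin h → ℕ) (m : ℕ) :
    {V | IsYoungChain h Y' Y m V}.Finite := by
  refine (Set.finite_Iic fun _ => Y).subset fun V hV k => ?_
  have hmono : Monotone V := Fin.monotone_iff_le_succ.2 hV.castSucc_le_succ
  exact (hmono (Fin.le_last k)).trans hV.2.1.le

theorem finite_youngChains (Y' Y : Fin h → ℕ) (m a : ℕ) : (youngChains Y' Y m a).Finite :=
  (finite_setOf_isYoungChain Y' Y m).subset fun _ hV => hV.1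

theorem isYoungChain_snoc {Y' Y z : Fin h → ℕ} {m : ℕ} {V : Fin (m + 1) → Fin h → ℕ} :
    IsYoungChain h Y' Y (m + 1) (Fin.snoc V z : Fin (m + 2) → Fin h → ℕ) ↔
      z = Y ∧ IsDecr h Y ∧ ∃ b, 0 < Y b ∧ IsYoungChain h Y' (lowerAt Y b) m V := by
  have h0 : (Fin.snoc V z : Fin (m + 2) → Fin h → ℕ) 0 = V 0 := by
    rw [← Fin.castSucc_zero, Fin.snoc_castSucc]
  rw [IsYoungChain, h0, Fin.snoc_last, Fin.forall_fin_succ' (n := m + 1)]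
  refine (and_congr_right fun _ => and_congr_right fun _ => and_congr_right fun _ =>
    Fin.forall_fin_succ').trans ?_
  simp only [IsYoungChain, Fin.snoc_last, Fin.snoc_castSucc, Fin.succ_castSucc, Fin.succ_last,
    update_eq_iff_lowerAt]
  constructor
  · rintro ⟨h1, rfl, ⟨h2, h3⟩, h4, b, hb, hV⟩
    exact ⟨rfl, h3, b, hb, h1, hV, h2, h4⟩
  · rintro ⟨rfl, h3, b, hb, h1, hV, h2, h4⟩
    exact ⟨h1, rfl, ⟨h2, h3⟩, h4, b, hb, hV⟩

theorem chainAt_of_le {m k : ℕ} (hk : k ≤ m) (Y : Fin h → ℕ) (V : Fin (m + 1) → Fin h → ℕ) :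
    chainAt h m Y V k = V ⟨k, Nat.lt_succ_of_le hk⟩ := by
  rw [chainAt, dif_pos]

theorem chainAt_snoc {m k : ℕ} (hk : k ≤ m) (Y W z : Fin h → ℕ)
    (V : Fin (m + 1) → Fin h → ℕ) :
    chainAt h (m + 1) Y (Fin.snoc V z : Fin (m + 2) → Fin h → ℕ) k = chainAt h m W V k := by
  rw [chainAt_of_le (by omega), chainAt_of_le hk]
  exact Fin.snoc_castSucc (α := fun _ => Fin h → ℕ) z V ⟨k, Nat.lt_succ_of_le hk⟩

theorem chainAt_snoc_last (m : ℕ) (Y z : Fin h → ℕ) (V : Fin (m + 1) → Fin h → ℕ) :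
    chainAt h (m + 1) Y (Fin.snoc V z : Fin (m + 2) → Fin h → ℕ) (m + 1) = z := by
  rw [chainAt_of_le le_rfl]
  exact Fin.snoc_last (α := fun _ => Fin h → ℕ) z V

theorem IsYoungChain.chainAt_last {Y' Y : Fin h → ℕ} {m : ℕ} {V : Fin (m + 1) → Fin h → ℕ}
    (hV : IsYoungChain h Y' Y m V) (W : Fin h → ℕ) : chainAt h m W V m = Y := by
  rw [chainAt_of_le le_rfl]
  exact hV.2.1

theorem eq_lowerAt_add_one_iff {Y : Fin h → ℕ} {b : Fin h} (hb : 0 < Y b) (i : Fin h) :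
    Y i = lowerAt Y b i + 1 ↔ i = b := by
  by_cases hi : i = b
  · subst hi; rw [lowerAt_self]; simp; omega
  · rw [lowerAt_of_ne Y hi]; simp [hi]

theorem eq_lowerAt_iff {Y : Fin h → ℕ} {b : Fin h} (hb : 0 < Y b) (i : Fin h) :
    Y i = lowerAt Y b i ↔ i ≠ b := by
  by_cases hi : i = b
  · subst hi; rw [lowerAt_self]; simp; omega
  · rw [lowerAt_of_ne Y hi]; simp [hi]

theorem IsYoungChain.ne_iff_eq_add_one {Y' Y : Fin h → ℕ} {m : ℕ}
    {V : Fin (m + 2) → Fin h → ℕ} (hV : IsYoungChain h Y' Y (m + 1) V) (W : Fin h → ℕ)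
    (i : Fin h) :
    chainAt h (m + 1) W V (m + 1) i ≠ chainAt h (m + 1) W V m i ↔
      chainAt h (m + 1) W V (m + 1) i = chainAt h (m + 1) W V m i + 1 := by
  rw [chainAt_of_le le_rfl, chainAt_of_le (Nat.le_succ m)]
  obtain ⟨b, hb⟩ := hV.2.2.2 (Fin.last m)
  obtain ⟨hb1, hb2⟩ := (update_eq_iff_lowerAt _ _ _).1 hb
  change V (Fin.last m).succ i ≠ V (Fin.last m).castSucc i ↔
    V (Fin.last m).succ i = V (Fin.last m).castSucc i + 1
  rw [hb2, eq_lowerAt_add_one_iff hb1, Ne, eq_lowerAt_iff hb1, not_not]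

theorem numReturns_snoc {Y' Y : Fin h → ℕ} {m : ℕ} {b : Fin h} {V : Fin (m + 1) → Fin h → ℕ}
    (hb : 0 < Y b) (hV : IsYoungChain h Y' (lowerAt Y b) m V) :
    numReturns h (m + 1) Y (Fin.snoc V Y : Fin (m + 2) → Fin h → ℕ) =
      numReturns h m (lowerAt Y b) V +
        if V ∈ youngChains Y' (lowerAt Y b) m (b + 1) then 0 else 1 := by
  rcases m with _ | m
  · have : V ∈ youngChains Y' (lowerAt Y b) 0 (b + 1) := ⟨hV, fun _ _ => rfl⟩
    simp [numReturns, this]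
  · have hI : Finset.Icc 2 (m + 2) = insert (m + 2) (Finset.Icc 2 (m + 1)) := by
      ext k
      simp only [Finset.mem_Icc, Finset.mem_insert]
      omega
    have hnew : (∃ i j : Fin h,
        chainAt h (m + 2) Y (Fin.snoc V Y : Fin (m + 3) → Fin h → ℕ) (m + 2) i =
          chainAt h (m + 2) Y (Fin.snoc V Y : Fin (m + 3) → Fin h → ℕ) (m + 2 - 1) i + 1 ∧
        chainAt h (m + 2) Y (Fin.snoc V Y : Fin (m + 3) → Fin h → ℕ) (m + 2 - 1) j =
          chainAt h (m + 2) Y (Fin.snoc V Y : Fin (m + 3) → Fin h → ℕ) (m + 2 - 2) j + 1 ∧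
        i < j) ↔ V ∉ youngChains Y' (lowerAt Y b) (m + 1) (b + 1) := by
      rw [chainAt_snoc_last, chainAt_snoc (W := lowerAt Y b) (by omega),
        chainAt_snoc (W := lowerAt Y b) (by omega), show m + 2 - 1 = m + 1 from rfl,
        show m + 2 - 2 = m from rfl]
      simp only [← hV.ne_iff_eq_add_one]
      rw [hV.chainAt_last]
      simp only [eq_lowerAt_add_one_iff hb, exists_and_left, exists_eq_left, youngChains,
        Set.mem_ofPred_eq, hV, true_and, not_forall, hV.chainAt_last]
      exact exists_congr fun j => by
        rw [and_comm, exists_prop, Nat.succ_le_iff, Fin.lt_def]; rfl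
    have hold : (Finset.Icc 2 (m + 1)).filter (fun k => ∃ i j : Fin h,
        chainAt h (m + 2) Y (Fin.snoc V Y : Fin (m + 3) → Fin h → ℕ) k i =
          chainAt h (m + 2) Y (Fin.snoc V Y : Fin (m + 3) → Fin h → ℕ) (k - 1) i + 1 ∧
        chainAt h (m + 2) Y (Fin.snoc V Y : Fin (m + 3) → Fin h → ℕ) (k - 1) j =
          chainAt h (m + 2) Y (Fin.snoc V Y : Fin (m + 3) → Fin h → ℕ) (k - 2) j + 1 ∧
        i < j) = (Finset.Icc 2 (m + 1)).filter (fun k => ∃ i j : Fin h,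
        chainAt h (m + 1) (lowerAt Y b) V k i =
          chainAt h (m + 1) (lowerAt Y b) V (k - 1) i + 1 ∧
        chainAt h (m + 1) (lowerAt Y b) V (k - 1) j =
          chainAt h (m + 1) (lowerAt Y b) V (k - 2) j + 1 ∧ i < j) := by
      refine Finset.filter_congr fun k hk => ?_
      have := (Finset.mem_Icc.1 hk).2
      rw [chainAt_snoc (W := lowerAt Y b) this,
        chainAt_snoc (W := lowerAt Y b) (show k - 1 ≤ m + 1 by omega),
        chainAt_snoc (W := lowerAt Y b) (show k - 2 ≤ m + 1 by omega)]
    rw [numReturns, numReturns, hI, Finset.filter_insert, hold]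
    by_cases hm : V ∈ youngChains Y' (lowerAt Y b) (m + 1) (b + 1)
    · rw [if_neg (by rw [hnew]; exact not_not.2 hm), if_pos hm, add_zero]
    · rw [if_pos (hnew.2 hm), if_neg hm, Finset.card_insert_of_notMem (by simp)]

theorem youngChains_top (Y' Y : Fin h → ℕ) (m : ℕ) :
    youngChains Y' Y m h = {V | IsYoungChain h Y' Y m V} := by
  ext V
  exact and_iff_left fun i hi => absurd i.2 (by omega)

theorem snoc_mem_youngChains {Y' Y z : Fin h → ℕ} {m a : ℕ} {V : Fin (m + 1) → Fin h → ℕ} :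
    (Fin.snoc V z : Fin (m + 2) → Fin h → ℕ) ∈ youngChains Y' Y (m + 1) a ↔
      z = Y ∧ IsDecr h Y ∧
        ∃ b : Fin h, (b.val < a ∧ 0 < Y b) ∧ V ∈ youngChains Y' (lowerAt Y b) m h := by
  simp only [youngChains_top]
  simp only [youngChains, Set.mem_ofPred_eq, isYoungChain_snoc, chainAt_snoc_last,
    Nat.add_sub_cancel, chainAt_snoc le_rfl Y Y z V]
  have key : ∀ b, 0 < Y b → IsYoungChain h Y' (lowerAt Y b) m V →
      ((∀ i : Fin h, a ≤ i → Y i = chainAt h m Y V m i) ↔ b.val < a) := by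
    intro b hb hV
    simp only [hV.chainAt_last, eq_lowerAt_iff hb]
    exact ⟨fun hi => not_le.1 fun hab => hi b hab rfl, fun hba i hi hib => by subst hib; omega⟩
  constructor
  · rintro ⟨⟨rfl, hd, b, hb, hV⟩, hi⟩
    exact ⟨rfl, hd, b, ⟨(key b hb hV).1 hi, hb⟩, hV⟩
  · rintro ⟨rfl, hd, b, ⟨hba, hb⟩, hV⟩
    exact ⟨⟨rfl, hd, b, hb, hV⟩, (key b hb hV).2 hba⟩

theorem sum_youngChains_succ {Y' Y : Fin h → ℕ} (hY : IsDecr h Y) (m a : ℕ)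
    (f : (Fin (m + 2) → Fin h → ℕ) → PowerSeries ℤ) :
    ∑ V ∈ (finite_youngChains Y' Y (m + 1) a).toFinset, f V =
      ∑ b : Fin h with b.val < a ∧ 0 < Y b,
        ∑ V ∈ (finite_youngChains Y' (lowerAt Y b) m h).toFinset, f (Fin.snoc V Y) := by
  rw [Finset.sum_sigma']
  symm
  refine Finset.sum_nbij
    (fun p : (_ : Fin h) × (Fin (m + 1) → Fin h → ℕ) =>
      (Fin.snoc p.2 Y : Fin (m + 2) → Fin h → ℕ)) ?_ ?_ ?_ fun _ _ => rfl
  · rintro ⟨b, V⟩ hV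
    simp only [Finset.mem_sigma, Finset.mem_filter, Finset.mem_univ, true_and,
      Set.Finite.mem_toFinset] at hV ⊢
    exact snoc_mem_youngChains.2 ⟨rfl, hY, b, hV⟩
  · rintro ⟨b, V⟩ hV ⟨b', V'⟩ hV' he
    obtain ⟨rfl, -⟩ := Fin.snoc_inj.1 he
    simp only [Finset.coe_sigma, Set.mem_sigma_iff, Finset.coe_filter, Finset.mem_univ, true_and,
      Set.mem_ofPred_eq, Set.Finite.coe_toFinset] at hV hV'
    have hl : lowerAt Y b = lowerAt Y b' := hV.2.1.2.1.symm.trans hV'.2.1.2.1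
    have : b = b' := by
      rw [← eq_lowerAt_add_one_iff hV'.1.2, ← hl, eq_lowerAt_add_one_iff hV.1.2]
    rw [this]
  · intro V hV
    rw [Set.Finite.coe_toFinset, ← Fin.snoc_init_self V] at hV
    obtain ⟨hz, -, b, hb⟩ := snoc_mem_youngChains.1 hV
    refine ⟨⟨b, Fin.init V⟩, ?_, ?_⟩
    · simpa only [Finset.coe_sigma, Set.mem_sigma_iff, Finset.coe_filter, Finset.mem_univ,
        true_and, Set.mem_ofPred_eq, Set.Finite.coe_toFinset] using hb
    · simp only [← hz, Fin.snoc_init_self]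

theorem sum_youngChains_eq_returnSeries {Y' : Fin h → ℕ} (hY' : IsDecr h Y') :
    ∀ (m : ℕ) (Y : Fin h → ℕ) (a : ℕ),
      ∑ V ∈ (finite_youngChains Y' Y m a).toFinset,
        (PowerSeries.X : PowerSeries ℤ) ^ numReturns h m Y V = returnSeries Y' m Y a
  | 0, Y, a => by
    have hmem : ∀ V, V ∈ youngChains Y' Y 0 a ↔ Y = Y' ∧ V = fun _ => Y' := by
      intro V
      constructor
      · rintro ⟨⟨h1, h2, -⟩, -⟩
        exact ⟨h2.symm.trans h1, funext fun k => by rw [Fin.fin_one_eq_zero k]; exact h1⟩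
      · rintro ⟨rfl, rfl⟩
        exact ⟨⟨rfl, rfl, fun _ => hY', fun k => k.elim0⟩, fun _ _ => rfl⟩
    rw [returnSeries]
    split_ifs with hY
    · have : (finite_youngChains Y' Y 0 a).toFinset = {fun _ => Y'} := by
        ext V
        rw [Set.Finite.mem_toFinset, hmem, Finset.mem_singleton, and_iff_right hY]
      rw [this, Finset.sum_singleton]
      simp [numReturns]
    · refine Finset.sum_eq_zero fun V hV => absurd ((hmem V).1 ?_).1 hY
      simpa using hV
  | m + 1, Y, a => by
    rw [returnSeries]
    split_ifs with hY
    · rw [sum_youngChains_succ hY]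
      refine Finset.sum_congr rfl fun b hb => ?_
      have hb0 : 0 < Y b := (Finset.mem_filter.1 hb).2.2
      rw [← sum_youngChains_eq_returnSeries hY' m _ h,
        ← sum_youngChains_eq_returnSeries hY' m _ (b + 1), Finset.mul_sum, Finset.mul_sum]
      have hf : (finite_youngChains Y' (lowerAt Y b) m (b + 1)).toFinset =
          (finite_youngChains Y' (lowerAt Y b) m h).toFinset.filter
            (· ∈ youngChains Y' (lowerAt Y b) m (b + 1)) := by
        ext V
        simp only [Finset.mem_filter, Set.Finite.mem_toFinset, youngChains_top]
        exact ⟨fun hV => ⟨hV.1, hV⟩, fun hV => hV.2⟩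
      rw [hf, Finset.sum_filter, ← Finset.sum_add_distrib]
      refine Finset.sum_congr rfl fun V hV => ?_
      rw [Set.Finite.mem_toFinset, youngChains_top] at hV
      rw [numReturns_snoc hb0 hV]
      split_ifs <;> ring
    · refine Finset.sum_eq_zero fun V hV => absurd ?_ hY
      rw [Set.Finite.mem_toFinset] at hV
      have := hV.1.2.2.1 (Fin.last _)
      rwa [hV.1.2.1] at this

theorem mk_ncard_returns_eq_returnSeries {Y' : Fin h → ℕ} (hY' : IsDecr h Y') (m : ℕ)
    (Y : Fin h → ℕ) :
    (PowerSeries.mk fun r =>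
      (Set.ncard {V : Fin (m + 1) → Fin h → ℕ |
        IsYoungChain h Y' Y m V ∧ numReturns h m Y V = r} : ℤ)) = returnSeries Y' m Y h := by
  rw [← sum_youngChains_eq_returnSeries hY']
  ext r
  have hs : {V : Fin (m + 1) → Fin h → ℕ | IsYoungChain h Y' Y m V ∧ numReturns h m Y V = r} =
      ((finite_youngChains Y' Y m h).toFinset.filter fun V => r = numReturns h m Y V :
        Finset (Fin (m + 1) → Fin h → ℕ)) := by
    ext V
    simp [youngChains_top, eq_comm]
  rw [PowerSeries.coeff_mk, hs, Set.ncard_coe_finset, map_sum]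
  simp [PowerSeries.coeff_X_pow]

end

/-- **Kreweras** : `∑_{r≥0} θ_r t^r = (1-t)^{m+1} ⬝ ∑_{r≥0} w_r t^r` in `ℤ[[t]]`,
where `θ_r` counts Young chains from `Y'` to `Y` with exactly `r` returns and
`w_r` counts multichains `Y' ≤ Z₁ ≤ ⋯ ≤ Z_r ≤ Y` of weakly decreasing tuples. -/
theorem kreweras_returns_multichains (h : ℕ) (hh : 1 ≤ h) (Y Y' : Fin h → ℕ)
    (hY : IsDecr h Y) (hY' : IsDecr h Y') (hle : ∀ i, Y' i ≤ Y i)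
    (m : ℕ) (hm : m = (∑ i, Y i) - (∑ i, Y' i)) :
    (PowerSeries.mk fun r =>
        (Set.ncard {V : Fin (m + 1) → Fin h → ℕ |
            IsYoungChain h Y' Y m V ∧ numReturns h m Y V = r} : ℤ)) =
    (1 - (PowerSeries.X : PowerSeries ℤ)) ^ (m + 1) *
      (PowerSeries.mk fun r =>
        (Set.ncard {Z : Fin r → Fin h → ℕ |
            (∀ k, IsDecr h (Z k)) ∧
            (∀ k i, Y' i ≤ Z k i) ∧ (∀ k i, Z k i ≤ Y i) ∧
            (∀ k l : Fin r, k ≤ l → ∀ i, Z k i ≤ Z l i)} : ℤ)) := by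
  have hsum : ∑ i, Y i = ∑ i, Y' i + m := by
    have : ∑ i, Y' i ≤ ∑ i, Y i := Finset.sum_le_sum fun i _ => hle i
    omega
  rw [mk_ncard_returns_eq_returnSeries hY', returnSeries_top hY' hY hle hsum]
  rfl
end
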